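/- arXiv:2605.26675 — 6 statements merged into one kernel-verified Lean document; each statement's English description precedes it below -/
import Mathlib

section
/- Let s ≥ 2 be an integer and let Δ ∈ ℝ^s satisfy Σ_{j=1}^s Δ_j = 0. Then min_{1 ≤ j ≤ s} Δ_j ≤ −‖Δ‖₂ / √(s(s−1)). -/
/-- geometric inequality used in the negative-drift lemma.
For an integer `s ≥ 2` and a zero-sum vector `Δ ∈ ℝ^s`,
`min_j Δ_j ≤ −‖Δ‖₂ / √(s(s−1))`. -/
theorem stmt2 (s : ℕ) (hs : 2 ≤ s) (Δ : EuclideanSpace ℝ (Fin s))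
    (hsum : ∑ j, Δ j = 0) :
    (Finset.univ : Finset (Fin s)).inf'
        ⟨⟨0, by omega⟩, Finset.mem_univ _⟩ (fun j => Δ j)
      ≤ -‖Δ‖ / Real.sqrt ((s : ℝ) * ((s : ℝ) - 1)) := by
  generalize hm : (Finset.univ : Finset (Fin s)).inf'
        ⟨⟨0, by omega⟩, Finset.mem_univ _⟩ (fun j => Δ j) = m
  have hle : ∀ j, m ≤ Δ j := fun j => by
    rw [← hm]
    exact Finset.inf'_le (fun j => Δ j) (Finset.mem_univ j)
  have hs' : (2 : ℝ) ≤ s := by exact_mod_cast hs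
  have hS : ∑ j, (Δ j - m) = -(s * m) := by
    rw [Finset.sum_sub_distrib, hsum]
    simp
  have hS0 : 0 ≤ ∑ j, (Δ j - m) :=
    Finset.sum_nonneg fun j _ => sub_nonneg.2 (hle j)
  have hm0 : m ≤ 0 := by
    by_contra h
    push Not at h
    nlinarith
  have hV : ‖Δ‖ ^ 2 = ∑ j, Δ j ^ 2 := EuclideanSpace.real_norm_sq_eq Δ
  have h1 : ∑ j, (Δ j - m) ^ 2 ≤ ∑ j, (Δ j - m) * -(s * m) := by
    refine Finset.sum_le_sum fun j _ => ?_
    have h2 : Δ j - m ≤ -(s * m) := by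
      rw [← hS]
      exact Finset.single_le_sum (f := fun j => Δ j - m)
        (fun i _ => sub_nonneg.2 (hle i)) (Finset.mem_univ j)
    have h3 := hle j
    rw [sq]
    exact mul_le_mul_of_nonneg_left h2 (sub_nonneg.2 h3)
  have h4 : ∑ j, (Δ j - m) ^ 2 = ‖Δ‖ ^ 2 + s * m ^ 2 := by
    have h5 : ∀ j, (Δ j - m) ^ 2 = Δ j ^ 2 - 2 * m * Δ j + m ^ 2 := fun j => by ring
    simp only [h5]
    rw [Finset.sum_add_distrib, Finset.sum_sub_distrib, ← Finset.mul_sum, hsum, hV]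
    simp
  rw [← Finset.sum_mul, hS, h4] at h1
  have hpos : (0 : ℝ) < s * (s - 1) := by nlinarith
  have hq : 0 < Real.sqrt ((s : ℝ) * ((s : ℝ) - 1)) := Real.sqrt_pos.2 hpos
  rw [le_div_iff₀ hq]
  have h6 : ‖Δ‖ ≤ -m * Real.sqrt ((s : ℝ) * ((s : ℝ) - 1)) := by
    refine abs_le_of_sq_le_sq' ?_ (mul_nonneg (neg_nonneg.2 hm0) hq.le) |>.2
    rw [mul_pow, Real.sq_sqrt hpos.le]
    nlinarith
  linarith
end

section
/- Let s ≥ 2 be an integer. On a probability space with filtration (F_n)_{n≥0}, let (J_{n+1})_{n≥0} be Fin s-valued random indices with J_{n+1} measurable with respect to F_{n+1}, and define Z_0 = 0 ∈ ℝ^s, Z_{n+1} = Z_n + e_{J_{n+1}}, Δ_n = Z_n − (n/s)·𝟙, W_n = ‖Δ_n‖₂, and a = √(1 − 1/s). Suppose there is a constant κ > 0 such that for every n ≥ 0, E[Δ_{n,J_{n+1}} | F_n] ≤ −κ·W_n almost surely. Then (i) Z_n/n → (1/s)·𝟙 almost surely, and (ii) for every η with 0 < η < 2κ/a², sup_{n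 ≥ 0} E[exp(η·W_n)] < ∞. -/
open MeasureTheory ProbabilityTheory Filter
open scoped ENNReal


lemma aux_sinh_le (y : ℝ) (hy : 0 ≤ y) : Real.sinh y ≤ y * Real.cosh y := by
  have hm : MonotoneOn (fun y : ℝ => y * Real.cosh y - Real.sinh y) (Set.Ici 0) := by
    apply monotoneOn_of_deriv_nonneg (convex_Ici 0)
    · fun_prop
    · fun_prop
    · intro x hx
      simp only [interior_Ici, Set.mem_Ioi] at hx
      have h : HasDerivAt (fun y : ℝ => y * Real.cosh y - Real.sinh y)
          (1 * Real.cosh x + x * Real.sinh x - Real.cosh x) x :=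
        ((hasDerivAt_id x).mul (Real.hasDerivAt_cosh x)).sub (Real.hasDerivAt_sinh x)
      rw [h.deriv]
      have := Real.sinh_nonneg_iff.2 hx.le
      nlinarith [mul_nonneg hx.le this]
  have := hm (Set.mem_Ici.2 le_rfl) (Set.mem_Ici.2 hy) hy
  simp at this
  linarith

lemma aux_rho (a κ η : ℝ) (ha : 0 < a) (hη : 0 < η) (h : η < 2 * κ / a ^ 2) :
    Real.cosh (η * a) - κ * (Real.sinh (η * a) / a) < 1 := by
  have hy : 0 < η * a / 2 := by positivity
  have e : η * a = 2 * (η * a / 2) := by ring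
  have h1 := aux_sinh_le _ hy.le
  have hs : 0 < Real.sinh (η * a / 2) := Real.sinh_pos_iff.2 hy
  have hc := Real.cosh_pos (η * a / 2)
  rw [lt_div_iff₀ (by positivity)] at h
  have h2 : η * a / 2 < κ / a := by
    rw [lt_div_iff₀ ha]; nlinarith
  have e1 : Real.cosh (η * a) = 1 + 2 * Real.sinh (η * a / 2) ^ 2 := by
    conv_lhs => rw [e, Real.cosh_two_mul, Real.cosh_sq]
    ring
  have e2 : Real.sinh (η * a) = 2 * Real.sinh (η * a / 2) * Real.cosh (η * a / 2) := by
    conv_lhs => rw [e, Real.sinh_two_mul]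
  have e3 : κ * (Real.sinh (η * a) / a) = (κ / a) * Real.sinh (η * a) := by ring
  rw [e3, e1, e2]
  have h3 : Real.sinh (η * a / 2) < κ / a * Real.cosh (η * a / 2) :=
    h1.trans_lt (mul_lt_mul_of_pos_right h2 hc)
  nlinarith [mul_pos hs (sub_pos.2 h3)]

lemma aux_exp_chord (a η x : ℝ) (ha : 0 < a) (hx : |x| ≤ a) :
    Real.exp (η * x) ≤ Real.cosh (η * a) + x * (Real.sinh (η * a) / a) := by
  obtain ⟨h1, h2⟩ := abs_le.1 hx
  have hp : 0 ≤ (1 + x / a) / 2 := by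
    have : -1 ≤ x / a := by rw [le_div_iff₀ ha]; linarith
    linarith
  have hq : 0 ≤ (1 - x / a) / 2 := by
    have : x / a ≤ 1 := by rw [div_le_iff₀ ha]; linarith
    linarith
  have hcv : ConvexOn ℝ Set.univ Real.exp := convexOn_exp
  have := hcv.right (Set.mem_univ (η * a)) (Set.mem_univ (-(η * a))) hp hq (by ring)
  simp only [smul_eq_mul] at this
  have e : (1 + x / a) / 2 * (η * a) + (1 - x / a) / 2 * -(η * a) = η * x := by
    field_simp; ring
  rw [e] at this
  rw [Real.cosh_eq, Real.sinh_eq]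
  refine this.trans (le_of_eq ?_)
  ring

/-- The truncated weight used to test the drift inequality. -/
noncomputable def auxH (η R w : ℝ) : ℝ := if R ≤ w then Real.exp (η * w) / w else 0

lemma aux_step (a η R w w' D : ℝ) (ha : 0 < a) (hη : 0 < η) (hR : 0 < R) (hw : 0 ≤ w)
    (hw' : 0 ≤ w') (hD : |D| ≤ a * w) (h : w' ^ 2 = w ^ 2 + 2 * D + a ^ 2) :
    Real.exp (η * w') ≤ Real.exp (η * (R + a)) + Real.exp (η * a ^ 2 / 2 * R⁻¹) *
      (auxH η R w * w * Real.cosh (η * a) + auxH η R w * D * (Real.sinh (η * a) / a)) := by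
  unfold auxH
  split_ifs with hRw
  · have hw0 : 0 < w := hR.trans_le hRw
    have h1 : w' ≤ w + D / w + a ^ 2 / 2 * w⁻¹ := by
      have : w + D / w + a ^ 2 / 2 * w⁻¹ = (2 * w ^ 2 + 2 * D + a ^ 2) / (2 * w) := by
        field_simp
      rw [this, le_div_iff₀ (by positivity)]
      nlinarith [sq_nonneg (w' - w)]
    have h2 : w⁻¹ ≤ R⁻¹ := inv_anti₀ hR hRw
    have h3 : η * w' ≤ η * a ^ 2 / 2 * R⁻¹ + (η * w + η * (D / w)) := by
      have : a ^ 2 / 2 * w⁻¹ ≤ a ^ 2 / 2 * R⁻¹ := by gcongr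
      nlinarith
    have h4 := aux_exp_chord a η (D / w) ha (by
      rw [abs_div, abs_of_pos hw0, div_le_iff₀ hw0]; exact hD)
    have h5 : Real.exp (η * w') ≤ Real.exp (η * a ^ 2 / 2 * R⁻¹) *
        (Real.exp (η * w) * (Real.cosh (η * a) + D / w * (Real.sinh (η * a) / a))) := by
      refine (Real.exp_le_exp.2 h3).trans ?_
      rw [Real.exp_add, Real.exp_add]
      gcongr
    have e : Real.exp (η * w) / w * w * Real.cosh (η * a) +
        Real.exp (η * w) / w * D * (Real.sinh (η * a) / a) =
        Real.exp (η * w) * (Real.cosh (η * a) + D / w * (Real.sinh (η * a) / a)) := by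
      field_simp
    rw [e]
    linarith [Real.exp_pos (η * (R + a))]
  · push Not at hRw
    have : w' ≤ R + a := by
      have := (abs_le.1 hD).2
      have : w' ≤ w + a := by nlinarith
      linarith
    have : Real.exp (η * w') ≤ Real.exp (η * (R + a)) := Real.exp_le_exp.2 (by gcongr)
    simpa using this

lemma aux_bound {Ω : Type} {m0 : MeasurableSpace Ω} (μ : Measure Ω) [IsProbabilityMeasure μ]
    (F : Filtration ℕ m0) (κ : ℝ) (W D : ℕ → Ω → ℝ) (a : ℝ) (ha : 0 < a)
    (hWm : ∀ n, Measurable[F n] (W n)) (hDm : ∀ n, Measurable (D n))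
    (hW0 : ∀ ω, W 0 ω = 0) (hWnn : ∀ n ω, 0 ≤ W n ω)
    (hD : ∀ n ω, |D n ω| ≤ a * W n ω)
    (hstep : ∀ n ω, W (n + 1) ω ^ 2 = W n ω ^ 2 + 2 * D n ω + a ^ 2)
    (hdrift : ∀ n, (μ[D n | F n]) ≤ᵐ[μ] (fun ω => -κ * W n ω))
    (η : ℝ) (hη : 0 < η) (hη2 : η < 2 * κ / a ^ 2) :
    ∃ B : ℝ, ∀ n, ∫⁻ ω, ENNReal.ofReal (Real.exp (η * W n ω)) ∂μ ≤ ENNReal.ofReal B := by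
  have hρ := aux_rho a κ η ha hη hη2
  set c := Real.cosh (η * a) with hc
  set sh := Real.sinh (η * a) / a with hsh
  have hshnn : 0 ≤ sh := div_nonneg (Real.sinh_nonneg_iff.2 (by positivity)) ha.le
  obtain ⟨ρ, hρ0, hρ1, hρc⟩ : ∃ ρ : ℝ, 0 ≤ ρ ∧ ρ < 1 ∧ c - κ * sh ≤ ρ :=
    ⟨max (c - κ * sh) 0, le_max_right _ _, max_lt hρ one_pos, le_max_left _ _⟩
  obtain ⟨R, hR, hRθ⟩ : ∃ R : ℝ, 0 < R ∧ Real.exp (η * a ^ 2 / 2 * R⁻¹) * ρ < 1 := by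
    have ht : Tendsto (fun R : ℝ => Real.exp (η * a ^ 2 / 2 * R⁻¹) * ρ) atTop (nhds ρ) := by
      have h1 : Tendsto (fun R : ℝ => η * a ^ 2 / 2 * R⁻¹) atTop (nhds 0) := by
        have := (tendsto_inv_atTop_zero (𝕜 := ℝ)).const_mul (η * a ^ 2 / 2)
        rwa [mul_zero] at this
      have h2 := (Real.continuous_exp.tendsto 0).comp h1
      simpa using h2.mul_const ρ
    exact ((eventually_gt_atTop 0).and (ht.eventually (gt_mem_nhds hρ1))).exists
  set g := Real.exp (η * a ^ 2 / 2 * R⁻¹) with hg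
  have hg0 : 0 < g := Real.exp_pos _
  have hWm0 : ∀ n, Measurable (W n) := fun n => (hWm n).mono (F.le n) le_rfl
  have hWle : ∀ n ω, W n ω ≤ a * n := by
    intro n ω
    induction n with
    | zero => simp [hW0]
    | succ n ih =>
      have h1 := hstep n ω
      have h2 := (abs_le.1 (hD n ω)).2
      have : W (n + 1) ω ≤ W n ω + a := by nlinarith [hWnn n ω, hWnn (n + 1) ω]
      push_cast
      linarith
  have hHm : Measurable (auxH η R) := by
    unfold auxH
    exact Measurable.ite measurableSet_Ici (by fun_prop) measurable_const
  have hHnn : ∀ w, 0 ≤ w → 0 ≤ auxH η R w := by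
    intro w hw; unfold auxH; split_ifs <;> positivity
  have hHw : ∀ w, 0 ≤ w → auxH η R w * w ≤ Real.exp (η * w) := by
    intro w hw; unfold auxH; split_ifs with h
    · have : w ≠ 0 := (hR.trans_le h).ne'
      rw [div_mul_cancel₀ _ this]
    · simp [Real.exp_nonneg]
  have hEle : ∀ n ω, Real.exp (η * W n ω) ≤ Real.exp (η * (a * n)) := fun n ω =>
    Real.exp_le_exp.2 (mul_le_mul_of_nonneg_left (hWle n ω) hη.le)
  have iE : ∀ n, Integrable (fun ω => Real.exp (η * W n ω)) μ := by
    intro n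
    refine Integrable.of_bound (C := Real.exp (η * (a * n)))
      (((hWm0 n).const_mul η).exp.aestronglyMeasurable) (ae_of_all _ fun ω => ?_)
    rw [Real.norm_eq_abs, abs_of_pos (Real.exp_pos _)]
    exact hEle n ω
  have iHW : ∀ n, Integrable (fun ω => auxH η R (W n ω) * W n ω) μ := by
    intro n
    refine (iE n).mono ((hHm.comp (hWm0 n)).mul (hWm0 n)).aestronglyMeasurable
      (ae_of_all _ fun ω => ?_)
    rw [Real.norm_eq_abs, Real.norm_eq_abs, abs_of_pos (Real.exp_pos _),
      abs_of_nonneg (mul_nonneg (hHnn _ (hWnn n ω)) (hWnn n ω))]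
    exact hHw _ (hWnn n ω)
  have iHD : ∀ n, Integrable (fun ω => auxH η R (W n ω) * D n ω) μ := by
    intro n
    refine ((iHW n).const_mul a).mono ((hHm.comp (hWm0 n)).mul (hDm n)).aestronglyMeasurable
      (ae_of_all _ fun ω => ?_)
    have h1 := hHnn _ (hWnn n ω)
    rw [Real.norm_eq_abs, Real.norm_eq_abs, abs_mul, abs_of_nonneg h1,
      abs_of_nonneg (mul_nonneg ha.le (mul_nonneg h1 (hWnn n ω)))]
    calc _ ≤ auxH η R (W n ω) * (a * W n ω) := mul_le_mul_of_nonneg_left (hD n ω) h1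
      _ = _ := by ring
  have iD : ∀ n, Integrable (D n) μ := by
    intro n
    refine Integrable.of_bound (C := a * (a * n)) (hDm n).aestronglyMeasurable
      (ae_of_all _ fun ω => ?_)
    exact (hD n ω).trans (mul_le_mul_of_nonneg_left (hWle n ω) ha.le)
  have hdr : ∀ n, ∫ ω, auxH η R (W n ω) * D n ω ∂μ ≤
      -κ * ∫ ω, auxH η R (W n ω) * W n ω ∂μ := by
    intro n
    have hsm : StronglyMeasurable[F n] (fun ω => auxH η R (W n ω)) :=
      (hHm.comp (hWm n)).stronglyMeasurable
    have hpull := condExp_mul_of_stronglyMeasurable_left (μ := μ) hsm (iHD n) (iD n)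
    rw [← integral_const_mul, ← integral_condExp (F.le n)]
    refine integral_mono_ae integrable_condExp ((iHW n).const_mul _) ?_
    filter_upwards [hpull, hdrift n] with ω h1 h2
    have h3 := mul_le_mul_of_nonneg_left h2 (hHnn _ (hWnn n ω))
    refine (le_of_eq h1).trans ?_
    simp only [Pi.mul_apply]
    linarith
  set C := Real.exp (η * (R + a)) with hC
  have hC0 : 0 < C := Real.exp_pos _
  have hrec : ∀ n, ∫ ω, Real.exp (η * W (n + 1) ω) ∂μ ≤
      C + g * ρ * ∫ ω, Real.exp (η * W n ω) ∂μ := by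
    intro n
    have i1 := (iHW n).mul_const c
    have i2 := (iHD n).mul_const sh
    have h1 : ∫ ω, Real.exp (η * W (n + 1) ω) ∂μ ≤ ∫ ω, (C + g *
        (auxH η R (W n ω) * W n ω * c + auxH η R (W n ω) * D n ω * sh)) ∂μ := by
      refine integral_mono (iE _) ((integrable_const C).add ((i1.add i2).const_mul g)) ?_
      intro ω
      exact aux_step a η R _ _ _ ha hη hR (hWnn n ω) (hWnn (n + 1) ω) (hD n ω) (hstep n ω)
    have i3 : Integrable (fun ω => g * (auxH η R (W n ω) * W n ω * c +
        auxH η R (W n ω) * D n ω * sh)) μ := (i1.add i2).const_mul g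
    have h2 : ∫ ω, (C + g *
        (auxH η R (W n ω) * W n ω * c + auxH η R (W n ω) * D n ω * sh)) ∂μ =
        C + g * ((∫ ω, auxH η R (W n ω) * W n ω ∂μ) * c +
          (∫ ω, auxH η R (W n ω) * D n ω ∂μ) * sh) := by
      rw [integral_add (integrable_const C) i3, integral_const_mul,
        integral_add i1 i2, integral_mul_const, integral_mul_const]
      simp
    have h3 : ∫ ω, auxH η R (W n ω) * W n ω ∂μ ≤ ∫ ω, Real.exp (η * W n ω) ∂μ :=
      integral_mono (iHW n) (iE n) fun ω => hHw _ (hWnn n ω)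
    have h4 : 0 ≤ ∫ ω, auxH η R (W n ω) * W n ω ∂μ :=
      integral_nonneg fun ω => mul_nonneg (hHnn _ (hWnn n ω)) (hWnn n ω)
    have h5 := mul_le_mul_of_nonneg_right (hdr n) hshnn
    rw [h2] at h1
    refine h1.trans ?_
    rw [mul_assoc]
    gcongr
    have h6 := mul_le_mul_of_nonneg_right hρc h4
    have h7 := mul_le_mul_of_nonneg_left h3 hρ0
    linarith
  have hθ0 : 0 ≤ g * ρ := mul_nonneg hg0.le hρ0
  refine ⟨1 + C / (1 - g * ρ), fun n => ?_⟩
  rw [← ofReal_integral_eq_lintegral_ofReal (iE n) (ae_of_all _ fun ω => Real.exp_nonneg _)]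
  refine ENNReal.ofReal_le_ofReal ?_
  have hpos : 0 < 1 - g * ρ := by linarith
  induction n with
  | zero =>
    simp [hW0]
    positivity
  | succ n ih =>
    refine (hrec n).trans ?_
    have h1 := mul_le_mul_of_nonneg_left ih hθ0
    have h2 : C = (1 - g * ρ) * (C / (1 - g * ρ)) := by field_simp
    set q := C / (1 - g * ρ)
    nlinarith

lemma aux_slln {Ω : Type} {m0 : MeasurableSpace Ω} (μ : Measure Ω)
    (W : ℕ → Ω → ℝ) (hWm : ∀ n, Measurable (W n)) (hWnn : ∀ n ω, 0 ≤ W n ω)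
    (η : ℝ) (hη : 0 < η) (B : ℝ)
    (hB : ∀ n, ∫⁻ ω, ENNReal.ofReal (Real.exp (η * W n ω)) ∂μ ≤ ENNReal.ofReal B) :
    ∀ᵐ ω ∂μ, Tendsto (fun n => W n ω / (n : ℝ)) atTop (nhds 0) := by
  let f : ℕ → Ω → ℝ≥0∞ := fun n ω => ENNReal.ofReal ((W n ω / n) ^ 2)
  have hfm : ∀ n, Measurable (f n) := fun n =>
    (((hWm n).div_const _).pow_const 2).ennreal_ofReal
  have hle : ∀ n, ∫⁻ ω, f n ω ∂μ ≤ ENNReal.ofReal (2 / η ^ 2 * (1 / (n : ℝ) ^ 2)) *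
      ENNReal.ofReal B := by
    intro n
    refine le_trans ?_ (mul_le_mul_right (hB n) _)
    rw [← lintegral_const_mul _ ((hWm n).const_mul η).exp.ennreal_ofReal]
    refine lintegral_mono fun ω => ?_
    rw [← ENNReal.ofReal_mul (by positivity)]
    refine ENNReal.ofReal_le_ofReal ?_
    have h1 := Real.quadratic_le_exp_of_nonneg (mul_nonneg hη.le (hWnn n ω))
    have h2 : (η * W n ω) ^ 2 / 2 ≤ Real.exp (η * W n ω) := by
      have := mul_nonneg hη.le (hWnn n ω)
      linarith
    calc (W n ω / n) ^ 2 = 2 / η ^ 2 * (1 / (n : ℝ) ^ 2) * ((η * W n ω) ^ 2 / 2) := by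
          field_simp
      _ ≤ _ := mul_le_mul_of_nonneg_left h2 (by positivity)
  have hsum : ∫⁻ ω, ∑' n, f n ω ∂μ ≠ ⊤ := by
    rw [lintegral_tsum fun n => (hfm n).aemeasurable]
    refine ne_top_of_le_ne_top ?_ (ENNReal.tsum_le_tsum hle)
    rw [ENNReal.tsum_mul_right]
    refine ENNReal.mul_ne_top ?_ ENNReal.ofReal_ne_top
    have hs : Summable fun n : ℕ => 2 / η ^ 2 * (1 / (n : ℝ) ^ 2) :=
      (Real.summable_one_div_nat_pow.2 one_lt_two).mul_left _
    exact hs.tsum_ofReal_ne_top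
  filter_upwards [ae_lt_top (Measurable.ennreal_tsum hfm) hsum] with ω hω
  have h0 := ENNReal.tendsto_atTop_zero_of_tsum_ne_top hω.ne
  have h1 := (ENNReal.tendsto_toReal ENNReal.zero_ne_top).comp h0
  have h2 : Tendsto (fun n : ℕ => (W n ω / n) ^ 2) atTop (nhds 0) := by
    refine h1.congr fun n => ?_
    simp only [Function.comp, f]
    exact ENNReal.toReal_ofReal (sq_nonneg _)
  have h3 := (Real.continuous_sqrt.tendsto 0).comp h2
  rw [Real.sqrt_zero] at h3
  refine h3.congr fun n => ?_
  exact Real.sqrt_sq (div_nonneg (hWnn n ω) (Nat.cast_nonneg n))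

/-- Corollary 2: abstract contractive informative-time allocation.
If the policy induces the negative drift `E[Δ_{n,J_{n+1}} | F_n] ≤ −κ·W_n` a.s. for
some `κ > 0`, then (i) `Z_n/n → (1/s)·𝟙` almost surely, and (ii) for every
`0 < η < 2κ/a²` with `a = √(1 − 1/s)`, `sup_{n≥0} E[exp(η·W_n)] < ∞`. -/
theorem stmt7
    {Ω : Type} {m0 : MeasurableSpace Ω} (μ : Measure Ω) [IsProbabilityMeasure μ]
    (F : Filtration ℕ m0)
    (s : ℕ) (hs : 2 ≤ s) (κ : ℝ) (hκ : 0 < κ)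
    (J : ℕ → Ω → Fin s)
    (hJmeas : ∀ n, @Measurable Ω (Fin s) (F (n + 1)) _ (J n))
    (Z : ℕ → Ω → EuclideanSpace ℝ (Fin s))
    (hZ0 : ∀ ω, Z 0 ω = 0)
    (hZ : ∀ n ω, Z (n + 1) ω = Z n ω + EuclideanSpace.single (J n ω) 1)
    (Δ : ℕ → Ω → EuclideanSpace ℝ (Fin s))
    (hΔ : ∀ n ω i, Δ n ω i = Z n ω i - (n : ℝ) / (s : ℝ))
    (W : ℕ → Ω → ℝ)
    (hW : ∀ n ω, W n ω = ‖Δ n ω‖)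
    (a : ℝ) (ha : a = Real.sqrt (1 - 1 / (s : ℝ)))
    (hdrift : ∀ n, (μ[(fun ω => Δ n ω (J n ω)) | F n])
        ≤ᵐ[μ] (fun ω => -κ * W n ω)) :
    (∀ᵐ ω ∂μ, ∀ j : Fin s,
        Tendsto (fun n => Z n ω j / (n : ℝ)) atTop (nhds (1 / (s : ℝ)))) ∧
    (∀ η : ℝ, 0 < η → η < 2 * κ / a ^ 2 →
        (⨆ n, ∫⁻ ω, ENNReal.ofReal (Real.exp (η * W n ω)) ∂μ) < ⊤) := by
  have hs0 : (0 : ℝ) < s := by exact_mod_cast (by omega : 0 < s)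
  have hs1 : (1 : ℝ) < s := by exact_mod_cast (by omega : 1 < s)
  have ha0' : 0 < 1 - 1 / (s : ℝ) := by
    rw [sub_pos, div_lt_one hs0]; exact hs1
  have ha0 : 0 < a := by rw [ha]; exact Real.sqrt_pos.2 ha0'
  have ha2 : a ^ 2 = 1 - 1 / (s : ℝ) := by rw [ha]; exact Real.sq_sqrt ha0'.le
  have hWsq : ∀ n ω, W n ω ^ 2 = ∑ i, Δ n ω i ^ 2 := by
    intro n ω
    rw [hW, EuclideanSpace.norm_sq_eq]
    simp
  have hWnn : ∀ n ω, 0 ≤ W n ω := fun n ω => by rw [hW]; exact norm_nonneg _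
  have hZs : ∀ n ω i, Z (n + 1) ω i = Z n ω i + if i = J n ω then 1 else 0 := by
    intro n ω i
    rw [hZ]
    simp [Pi.single_apply]
  have hΔs : ∀ n ω i, Δ (n + 1) ω i = Δ n ω i + ((if i = J n ω then 1 else 0) - 1 / (s : ℝ)) := by
    intro n ω i
    rw [hΔ, hΔ, hZs]
    push_cast
    ring
  have hsum0 : ∀ n ω, ∑ i, Δ n ω i = 0 := by
    intro n ω
    induction n with
    | zero => simp [hΔ, hZ0]
    | succ n ih =>
      simp only [hΔs, Finset.sum_add_distrib, Finset.sum_sub_distrib, ih]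
      simp [hs0.ne']
  -- inner product of the imbalance with the centered increment, and the squared increment
  have hv1 : ∀ n ω, ∑ i, Δ n ω i * ((if i = J n ω then 1 else 0) - 1 / (s : ℝ)) =
      Δ n ω (J n ω) := by
    intro n ω
    simp only [mul_sub, Finset.sum_sub_distrib, ← Finset.sum_mul, hsum0]
    simp
  have hv2 : ∀ n ω, ∑ i, ((if i = J n ω then 1 else 0) - 1 / (s : ℝ)) ^ 2 = a ^ 2 := by
    intro n ω
    have : ∀ i, ((if i = J n ω then 1 else 0) - 1 / (s : ℝ)) ^ 2 =
        (if i = J n ω then 1 - 2 / (s : ℝ) else 0) + 1 / (s : ℝ) ^ 2 := by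
      intro i; split_ifs <;> ring
    simp only [this, Finset.sum_add_distrib]
    rw [ha2]
    simp
    field_simp
    ring
  have hstep : ∀ n ω, W (n + 1) ω ^ 2 = W n ω ^ 2 + 2 * Δ n ω (J n ω) + a ^ 2 := by
    intro n ω
    rw [hWsq, hWsq, ← hv1, ← hv2 n ω, Finset.mul_sum, ← Finset.sum_add_distrib,
      ← Finset.sum_add_distrib]
    refine Finset.sum_congr rfl fun i _ => ?_
    rw [hΔs]; ring
  have hD : ∀ n ω, |Δ n ω (J n ω)| ≤ a * W n ω := by
    intro n ω
    refine abs_le_of_sq_le_sq ?_ (mul_nonneg ha0.le (hWnn n ω))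
    have := Finset.sum_mul_sq_le_sq_mul_sq Finset.univ (fun i => Δ n ω i)
      (fun i => (if i = J n ω then 1 else 0) - 1 / (s : ℝ))
    rw [hv1, hv2, ← hWsq] at this
    linarith
  have hZm : ∀ n i, Measurable[F n] (fun ω => Z n ω i) := by
    intro n
    induction n with
    | zero => intro i; simp only [hZ0]; exact measurable_const
    | succ n ih =>
      intro i
      simp only [hZs]
      refine Measurable.add ((ih i).mono (F.mono (Nat.le_succ n)) le_rfl) ?_
      exact (measurable_of_countable (fun j : Fin s => if i = j then (1 : ℝ) else 0)).comp
        (hJmeas n)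
  have hWm : ∀ n, Measurable[F n] (W n) := by
    intro n
    have : W n = fun ω => Real.sqrt (∑ i, (Z n ω i - (n : ℝ) / s) ^ 2) := by
      funext ω
      rw [← Real.sqrt_sq (hWnn n ω), hWsq]
      simp only [hΔ]
    rw [this]
    refine Measurable.sqrt (Finset.measurable_sum _ fun i _ => ?_)
    exact ((hZm n i).sub_const _).pow_const 2
  have hWm0 : ∀ n, Measurable (W n) := fun n => (hWm n).mono (F.le n) le_rfl
  have hDm : ∀ n, Measurable (fun ω => Δ n ω (J n ω)) := by
    intro n
    have : (fun ω => Δ n ω (J n ω)) = fun ω => (W (n + 1) ω ^ 2 - W n ω ^ 2 - a ^ 2) / 2 := by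
      funext ω; rw [hstep]; ring
    rw [this]
    exact ((((hWm0 _).pow_const 2).sub ((hWm0 _).pow_const 2)).sub_const _).div_const _
  have hW0 : ∀ ω, W 0 ω = 0 := by
    intro ω
    have := hWsq 0 ω
    simp only [hΔ, hZ0] at this
    simpa using this
  have key := aux_bound μ F κ W (fun n ω => Δ n ω (J n ω)) a ha0 hWm hDm hW0 hWnn hD hstep hdrift
  refine ⟨?_, fun η hη hη2 => ?_⟩
  · have hpos : 0 < κ / a ^ 2 := by positivity
    obtain ⟨B, hB⟩ := key (κ / a ^ 2) hpos (by
      have : 2 * κ / a ^ 2 = 2 * (κ / a ^ 2) := by ring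
      linarith)
    filter_upwards [aux_slln μ W hWm0 hWnn _ hpos B hB] with ω hω j
    rw [tendsto_iff_norm_sub_tendsto_zero]
    refine squeeze_zero' (Eventually.of_forall fun n => norm_nonneg _) ?_ hω
    filter_upwards [eventually_gt_atTop 0] with n hn
    have hn' : (0 : ℝ) < n := by exact_mod_cast hn
    have e : Z n ω j / n - 1 / s = Δ n ω j / n := by
      rw [hΔ]; field_simp
    rw [e, norm_div, Real.norm_of_nonneg hn'.le, hW]
    gcongr
    exact PiLp.norm_apply_le _ j
  · obtain ⟨B, hB⟩ := key η hη hη2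
    exact (iSup_le hB).trans_lt ENNReal.ofReal_lt_top
end

section
/- Let s ≥ 2, α ∈ (0,1], and κ > 0. On a probability space with filtration (F_n)_{n≥0}, let (J_{n+1})_{n≥0} be Fin s-valued random indices and (B_{n+1})_{n≥0} be {0,1}-valued random variables, both F_{n+1}-measurable, and define Z_0 = 0 ∈ ℝ^s, Z_{n+1} = Z_n + e_{J_{n+1}}, Δ_n = Z_n − (n/s)·𝟙, W_n = ‖Δ_n‖₂, a = √(1 − 1/s). Suppose that for every n ≥ 0, almost surely E[Δ_{n,J_{n+1}}·1{B_{n+1}=1} | F_n] ≤ −α·κ·W_n and E[Δ_{n,J_{n+1}}·1{B_{n+1}=0} | F_n] ≤ 0. Then for every n ≥ 0, E[Δ_{n,J_{n+1}} | F_n] ≤ −α·κ·W_n almost surely; consequently Z_n/n → (1/s)·𝟙 almost surely, and for every η with 0 < η < 2ακ/a², sup_{n ≥ 0} E[exp(η·W_n)] < ∞. -/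
open MeasureTheory ProbabilityTheory Filter
open scoped ENNReal

lemma mix_sinh_le {y : ℝ} (hy : 0 ≤ y) : Real.sinh y ≤ y * Real.cosh y := by
  have hd : ∀ x : ℝ, HasDerivAt (fun x => x * Real.cosh x - Real.sinh x) (x * Real.sinh x) x := by
    intro x
    have := ((hasDerivAt_id x).mul (Real.hasDerivAt_cosh x)).sub (Real.hasDerivAt_sinh x)
    refine this.congr_deriv ?_
    simp
  have hm : MonotoneOn (fun x => x * Real.cosh x - Real.sinh x) (Set.Ici 0) := by
    refine monotoneOn_of_deriv_nonneg (convex_Ici 0)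
      (fun x _ => (hd x).continuousAt.continuousWithinAt)
      (fun x _ => (hd x).differentiableAt.differentiableWithinAt) ?_
    intro x hx
    rw [interior_Ici] at hx
    rw [(hd x).deriv]
    exact mul_nonneg (le_of_lt hx) (Real.sinh_nonneg_iff.2 (le_of_lt hx))
  have := hm (Set.mem_Ici.2 le_rfl) (Set.mem_Ici.2 hy) hy
  simp at this
  exact this

lemma mix_rho_lt {x c : ℝ} (hx : 0 < x) (hc : x / 2 < c) :
    Real.cosh x - c * Real.sinh x < 1 := by
  obtain ⟨y, rfl⟩ : ∃ y, x = 2 * y := ⟨x / 2, by ring⟩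
  have hy : 0 < y := by linarith
  rw [Real.cosh_two_mul, Real.sinh_two_mul]
  have h1 := Real.cosh_sq y
  have h2 := mix_sinh_le hy.le
  have h3 : 0 < Real.sinh y := Real.sinh_pos_iff.2 hy
  have h4 := Real.cosh_pos y
  have h5 : Real.sinh y < c * Real.cosh y := by
    refine h2.trans_lt ?_
    apply mul_lt_mul_of_pos_right _ h4
    linarith
  nlinarith [mul_lt_mul_of_pos_left h5 h3]

lemma mix_pointwise {W W' d a η R : ℝ} (ha : 0 < a) (hη : 0 < η) (hR : 0 < R) (hWR : R ≤ W)
    (hsq : W' ^ 2 = W ^ 2 + 2 * d + a ^ 2) (hab : |W' - W| ≤ a) :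
    Real.exp (η * W') ≤ Real.exp (η * W) * (Real.cosh (η * a) + Real.sinh (η * a) / a * (a ^ 2 / (2 * R)))
      + Real.exp (η * W) / W * (Real.sinh (η * a) / a) * d := by
  have hWp : 0 < W := hR.trans_le hWR
  have hD : W' - W ≤ d / W + a ^ 2 / (2 * R) := by
    have h1 : W' - W ≤ d / W + a ^ 2 / (2 * W) := by
      have : d / W + a ^ 2 / (2 * W) = (2 * d + a ^ 2) / (2 * W) := by field_simp
      rw [this, le_div_iff₀ (by positivity)]
      nlinarith [sq_nonneg (W' - W)]
    have h2 : a ^ 2 / (2 * W) ≤ a ^ 2 / (2 * R) := by gcongr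
    linarith
  have ht : |(W' - W) / a| ≤ 1 := by
    rw [abs_div, abs_of_pos ha, div_le_one ha]; exact hab
  have he := Real.exp_mul_le_cosh_add_mul_sinh ht (η * a)
  have hs : 0 < Real.sinh (η * a) := Real.sinh_pos_iff.2 (by positivity)
  have e1 : (W' - W) / a * (η * a) = η * W' - η * W := by field_simp
  rw [e1] at he
  have h3 : (W' - W) / a * Real.sinh (η * a) ≤ Real.sinh (η * a) / a * (d / W + a ^ 2 / (2 * R)) := by
    calc _ = Real.sinh (η * a) / a * (W' - W) := by ring
      _ ≤ _ := by gcongr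
  calc Real.exp (η * W') = Real.exp (η * W) * Real.exp (η * W' - η * W) := by
        rw [← Real.exp_add]; ring_nf
    _ ≤ Real.exp (η * W) * (Real.cosh (η * a) + Real.sinh (η * a) / a * (d / W + a ^ 2 / (2 * R))) := by
        gcongr; linarith
    _ = _ := by ring

lemma mix_step {Ω : Type} {m m0 : MeasurableSpace Ω} (μ : Measure Ω) [IsProbabilityMeasure μ]
    (hm : m ≤ m0) {W W' d : Ω → ℝ} {a η R K lam ρ : ℝ} (ha : 0 < a) (hη : 0 < η) (hR : 0 < R)
    (hWm : Measurable[m] W) (hW'm : Measurable W') (hdm : Measurable d)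
    (hW0 : ∀ ω, 0 ≤ W ω) (hWK : ∀ ω, W ω ≤ K) (hW'0 : ∀ ω, 0 ≤ W' ω)
    (hd : ∀ ω, |d ω| ≤ a * W ω)
    (hsq : ∀ ω, W' ω ^ 2 = W ω ^ 2 + 2 * d ω + a ^ 2) (hab : ∀ ω, |W' ω - W ω| ≤ a)
    (hdrift : μ[d | m] ≤ᵐ[μ] fun ω => -lam * W ω)
    (hρ0 : 0 ≤ ρ)
    (hρ : Real.cosh (η * a) + Real.sinh (η * a) / a * (-lam + a ^ 2 / (2 * R)) ≤ ρ) :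
    ∫ ω, Real.exp (η * W' ω) ∂μ ≤ ρ * ∫ ω, Real.exp (η * W ω) ∂μ + Real.exp (η * (R + a)) := by
  classical
  have hWm0 : Measurable W := hWm.mono hm le_rfl
  have hs : 0 < Real.sinh (η * a) := Real.sinh_pos_iff.2 (by positivity)
  set S := Real.sinh (η * a) / a with hS
  have hSp : 0 < S := by positivity
  set c1 := Real.cosh (η * a) + S * (a ^ 2 / (2 * R)) with hc1
  have hc1p : 0 < c1 := by have := Real.cosh_pos (η * a); positivity
  let T : Set Ω := {ω | R ≤ W ω}
  have hT : MeasurableSet[m] T := measurableSet_le measurable_const hWm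
  let G : Ω → ℝ := T.indicator (fun ω => Real.exp (η * W ω))
  let g : Ω → ℝ := T.indicator (fun ω => Real.exp (η * W ω) / W ω * S)
  have hGm : Measurable[m] G :=
    (Real.measurable_exp.comp (hWm.const_mul η)).indicator hT
  have hgm : Measurable[m] g :=
    (((Real.measurable_exp.comp (hWm.const_mul η)).div hWm).mul_const S).indicator hT
  have hexpK : ∀ ω, Real.exp (η * W ω) ≤ Real.exp (η * K) := fun ω =>
    Real.exp_le_exp.2 (mul_le_mul_of_nonneg_left (hWK ω) hη.le)
  have hg0 : ∀ ω, 0 ≤ g ω := fun ω => Set.indicator_nonneg (fun x _ => by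
    have := hW0 x; positivity) ω
  have hG0 : ∀ ω, 0 ≤ G ω := fun ω => Set.indicator_nonneg (fun x _ => by positivity) ω
  have hGle : ∀ ω, G ω ≤ Real.exp (η * W ω) := fun ω => by
    by_cases h : ω ∈ T <;> simp [G, h]
    positivity
  have hgW : ∀ ω, g ω * W ω = S * G ω := fun ω => by
    by_cases h : ω ∈ T
    · have : 0 < W ω := hR.trans_le h
      simp [G, g, h]; field_simp
    · simp [G, g, h]
  have hgb : ∀ ω, ‖g ω‖ ≤ Real.exp (η * K) / R * S := fun ω => by
    rw [Real.norm_of_nonneg (hg0 ω)]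
    by_cases h : ω ∈ T
    · have h' : R ≤ W ω := h
      simp only [g, Set.indicator_of_mem h]
      gcongr
      exact hWK ω
    · simp only [g, Set.indicator_of_notMem h]; positivity
  have hdint : Integrable d μ := by
    refine Integrable.of_bound hdm.aestronglyMeasurable (a * K) (ae_of_all _ fun ω => ?_)
    exact (hd ω).trans (mul_le_mul_of_nonneg_left (hWK ω) ha.le)
  have hgdint : Integrable (g * d) μ :=
    hdint.bdd_mul (hgm.mono hm le_rfl).aestronglyMeasurable (ae_of_all _ hgb)
  have hEint : Integrable (fun ω => Real.exp (η * W ω)) μ := by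
    refine Integrable.of_bound (by fun_prop) (Real.exp (η * K)) (ae_of_all _ fun ω => ?_)
    rw [Real.norm_of_nonneg (by positivity)]; exact hexpK ω
  have hGint : Integrable G μ := by
    refine Integrable.of_bound (hGm.mono hm le_rfl).aestronglyMeasurable (Real.exp (η * K))
      (ae_of_all _ fun ω => ?_)
    rw [Real.norm_of_nonneg (hG0 ω)]; exact (hGle ω).trans (hexpK ω)
  have hE'int : Integrable (fun ω => Real.exp (η * W' ω)) μ := by
    refine Integrable.of_bound (by fun_prop) (Real.exp (η * (K + a))) (ae_of_all _ fun ω => ?_)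
    rw [Real.norm_of_nonneg (by positivity)]
    have h1 := (abs_le.1 (hab ω)).2
    have h2 := hWK ω
    gcongr; linarith
  have hpt : ∀ ω, Real.exp (η * W' ω) ≤ (c1 * G ω + (g * d) ω) + Real.exp (η * (R + a)) := by
    intro ω
    by_cases h : ω ∈ T
    · have := mix_pointwise ha hη hR h (hsq ω) (hab ω)
      have e : Real.exp (η * (R + a)) > 0 := Real.exp_pos _
      simp only [G, g, Pi.mul_apply, Set.indicator_of_mem h]
      linarith
    · simp only [G, g, Pi.mul_apply, Set.indicator_of_notMem h]
      have h' : W ω < R := not_le.1 h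
      have h1 := (abs_le.1 (hab ω)).2
      have : Real.exp (η * W' ω) ≤ Real.exp (η * (R + a)) := by gcongr; linarith
      linarith
  have hgd : ∫ ω, (g * d) ω ∂μ ≤ -lam * S * ∫ ω, G ω ∂μ := by
    have hpull := condExp_stronglyMeasurable_mul_of_bound (μ := μ) hm hgm.stronglyMeasurable hdint _
      (ae_of_all _ hgb)
    rw [← integral_condExp hm, ← integral_const_mul]
    refine integral_mono_ae integrable_condExp (hGint.const_mul _) ?_
    filter_upwards [hpull, hdrift] with ω h1 h2
    rw [h1]
    calc g ω * (μ[d | m]) ω ≤ g ω * (-lam * W ω) := mul_le_mul_of_nonneg_left h2 (hg0 ω)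
      _ = -lam * (g ω * W ω) := by ring
      _ = -lam * S * G ω := by rw [hgW]; ring
  have hGE : ∫ ω, G ω ∂μ ≤ ∫ ω, Real.exp (η * W ω) ∂μ := integral_mono hGint hEint hGle
  have hGn : 0 ≤ ∫ ω, G ω ∂μ := integral_nonneg hG0
  calc ∫ ω, Real.exp (η * W' ω) ∂μ
      ≤ ∫ ω, ((c1 * G ω + (g * d) ω) + Real.exp (η * (R + a))) ∂μ :=
        integral_mono hE'int (((hGint.const_mul _).add hgdint).add (integrable_const _)) hpt
    _ = c1 * ∫ ω, G ω ∂μ + ∫ ω, (g * d) ω ∂μ + Real.exp (η * (R + a)) := by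
        have hI : Integrable (fun ω => c1 * G ω + (g * d) ω) μ := (hGint.const_mul _).add hgdint
        rw [integral_add hI (integrable_const _),
          integral_add (hGint.const_mul _) hgdint, integral_const_mul]
        simp
    _ ≤ ρ * ∫ ω, G ω ∂μ + Real.exp (η * (R + a)) := by
        have : (c1 + -lam * S) * ∫ ω, G ω ∂μ ≤ ρ * ∫ ω, G ω ∂μ := by
          apply mul_le_mul_of_nonneg_right _ hGn
          rw [hc1]; linarith
        linarith
    _ ≤ _ := by gcongr

/-- Corollary 3: α-mixture policy.
If the greedy part gives drift `E[Δ_{n,J_{n+1}}·1{B_{n+1}=1} | F_n] ≤ −ακ·W_n` and the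
exploratory part gives `E[Δ_{n,J_{n+1}}·1{B_{n+1}=0} | F_n] ≤ 0`, then the mixed policy
satisfies `E[Δ_{n,J_{n+1}} | F_n] ≤ −ακ·W_n` a.s.; consequently `Z_n/n → (1/s)·𝟙`
almost surely, and for every `0 < η < 2ακ/a²`, `sup_{n≥0} E[exp(η·W_n)] < ∞`. -/
theorem stmt8
    {Ω : Type} {m0 : MeasurableSpace Ω} (μ : Measure Ω) [IsProbabilityMeasure μ]
    (F : Filtration ℕ m0)
    (s : ℕ) (hs : 2 ≤ s) (α : ℝ) (hα : α ∈ Set.Ioc (0 : ℝ) 1) (κ : ℝ) (hκ : 0 < κ)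
    (J : ℕ → Ω → Fin s)
    (hJmeas : ∀ n, @Measurable Ω (Fin s) (F (n + 1)) _ (J n))
    (B : ℕ → Ω → ℕ)
    (hB01 : ∀ n ω, B n ω = 0 ∨ B n ω = 1)
    (hBmeas : ∀ n, @Measurable Ω ℕ (F (n + 1)) _ (B n))
    (Z : ℕ → Ω → EuclideanSpace ℝ (Fin s))
    (hZ0 : ∀ ω, Z 0 ω = 0)
    (hZ : ∀ n ω, Z (n + 1) ω = Z n ω + EuclideanSpace.single (J n ω) 1)
    (Δ : ℕ → Ω → EuclideanSpace ℝ (Fin s))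
    (hΔ : ∀ n ω i, Δ n ω i = Z n ω i - (n : ℝ) / (s : ℝ))
    (W : ℕ → Ω → ℝ)
    (hW : ∀ n ω, W n ω = ‖Δ n ω‖)
    (a : ℝ) (ha : a = Real.sqrt (1 - 1 / (s : ℝ)))
    (hdrift1 : ∀ n,
        (μ[(fun ω => Δ n ω (J n ω) * (if B n ω = 1 then (1 : ℝ) else 0)) | F n])
          ≤ᵐ[μ] (fun ω => -(α * κ) * W n ω))
    (hdrift0 : ∀ n,
        (μ[(fun ω => Δ n ω (J n ω) * (if B n ω = 0 then (1 : ℝ) else 0)) | F n])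
          ≤ᵐ[μ] (fun _ => (0 : ℝ))) :
    (∀ n, (μ[(fun ω => Δ n ω (J n ω)) | F n])
        ≤ᵐ[μ] (fun ω => -(α * κ) * W n ω)) ∧
    (∀ᵐ ω ∂μ, ∀ j : Fin s,
        Tendsto (fun n => Z n ω j / (n : ℝ)) atTop (nhds (1 / (s : ℝ)))) ∧
    (∀ η : ℝ, 0 < η → η < 2 * α * κ / a ^ 2 →
        (⨆ n, ∫⁻ ω, ENNReal.ofReal (Real.exp (η * W n ω)) ∂μ) < ⊤) := by
  have hspos : (0 : ℝ) < s := by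
    have : (2 : ℝ) ≤ s := by exact_mod_cast hs
    linarith
  have hs2 : (2 : ℝ) ≤ s := by exact_mod_cast hs
  have ha2 : a ^ 2 = 1 - 1 / (s : ℝ) := by
    rw [ha, Real.sq_sqrt]
    have : 1 / (s : ℝ) ≤ 1 := by rw [div_le_one hspos]; linarith
    linarith
  have ha2pos : 0 < a ^ 2 := by
    rw [ha2]
    have : 1 / (s : ℝ) < 1 := by rw [div_lt_one hspos]; linarith
    linarith
  have hapos : 0 < a := by
    have h0 : 0 ≤ a := by rw [ha]; exact Real.sqrt_nonneg _
    rcases h0.eq_or_lt with h | h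
    · rw [← h] at ha2pos; simp at ha2pos
    · exact h
  have hlam : 0 < α * κ := mul_pos hα.1 hκ
  -- measurability
  have hZm : ∀ n, ∀ i, Measurable[F n] (fun ω => Z n ω i) := by
    intro n
    induction n with
    | zero => intro i; simp only [hZ0]; exact measurable_const
    | succ n ih =>
      intro i
      have h1 : (fun ω => Z (n + 1) ω i) = fun ω => Z n ω i + (if i = J n ω then (1 : ℝ) else 0) := by
        funext ω
        rw [hZ]
        simp [PiLp.single_apply]
      rw [h1]
      refine Measurable.add ((ih i).mono (F.mono n.le_succ) le_rfl) ?_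
      exact (measurable_from_top (f := fun j : Fin s => if i = j then (1 : ℝ) else 0)).comp
        (hJmeas n)
  have hΔm : ∀ n, ∀ i, Measurable[F n] (fun ω => Δ n ω i) := by
    intro n i
    simp only [hΔ]
    exact (hZm n i).sub_const _
  have hWm : ∀ n, Measurable[F n] (W n) := by
    intro n
    have : W n = fun ω => Real.sqrt (∑ i, (Δ n ω i) ^ 2) := by
      funext ω; rw [hW, EuclideanSpace.norm_eq]; simp
    rw [this]
    refine Real.continuous_sqrt.measurable.comp ?_
    exact Finset.measurable_sum _ fun i _ => (hΔm n i).pow_const 2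
  have hdm : ∀ n, Measurable (fun ω => Δ n ω (J n ω)) := by
    intro n
    have : (fun ω => Δ n ω (J n ω)) = fun ω => ∑ i, Δ n ω i * (if i = J n ω then (1 : ℝ) else 0) := by
      funext ω; simp
    rw [this]
    refine Finset.measurable_sum _ fun i _ => ((hΔm n i).mono (F.le n) le_rfl).mul ?_
    exact (measurable_from_top (f := fun j : Fin s => if i = j then (1 : ℝ) else 0)).comp
        ((hJmeas n).mono (F.le _) le_rfl)
  -- geometry
  have hsum0 : ∀ n ω, ∑ i, Δ n ω i = 0 := by
    intro n ω
    have hz : ∑ i, Z n ω i = n := by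
      induction n with
      | zero => simp [hZ0]
      | succ n ih => simp [hZ, Finset.sum_add_distrib, ih, PiLp.single_apply]
    simp only [hΔ, Finset.sum_sub_distrib, hz]
    simp
    field_simp
    ring
  let v : Fin s → EuclideanSpace ℝ (Fin s) := fun j =>
    EuclideanSpace.single j 1 - WithLp.toLp 2 (fun _ => 1 / (s : ℝ))
  have hv : ∀ j i, v j i = (if i = j then 1 else 0) - 1 / (s : ℝ) := by
    intro j i
    simp [v, PiLp.single_apply]
  have hΔv : ∀ n ω, Δ (n + 1) ω = Δ n ω + v (J n ω) := by
    intro n ω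
    ext i
    rw [PiLp.add_apply, hv, hΔ, hΔ, hZ]
    simp [PiLp.single_apply]
    ring
  have hvn2 : ∀ j, ‖v j‖ ^ 2 = a ^ 2 := by
    intro j
    rw [EuclideanSpace.norm_sq_eq, ha2]
    simp only [hv, Real.norm_eq_abs, sq_abs]
    have : ∀ i : Fin s, ((if i = j then (1 : ℝ) else 0) - 1 / (s : ℝ)) ^ 2
        = (if i = j then (1 - 2 / (s : ℝ)) else 0) + 1 / (s : ℝ) ^ 2 := by
      intro i
      split_ifs <;> ring
    simp only [this, Finset.sum_add_distrib]
    simp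
    field_simp
    ring
  have hvn : ∀ j, ‖v j‖ = a := by
    intro j
    exact (sq_eq_sq₀ (norm_nonneg _) hapos.le).1 (hvn2 j)
  have hin : ∀ n ω, inner ℝ (Δ n ω) (v (J n ω)) = Δ n ω (J n ω) := by
    intro n ω
    rw [PiLp.inner_apply]
    simp only [hv]
    simp [sub_mul, Finset.sum_sub_distrib, ← Finset.mul_sum, hsum0]
  have hsq : ∀ n ω, W (n + 1) ω ^ 2 = W n ω ^ 2 + 2 * Δ n ω (J n ω) + a ^ 2 := by
    intro n ω
    rw [hW, hW, hΔv, norm_add_sq_real, hin, hvn]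
  have hd : ∀ n ω, |Δ n ω (J n ω)| ≤ a * W n ω := by
    intro n ω
    have := abs_real_inner_le_norm (Δ n ω) (v (J n ω))
    rw [hin, hvn, ← hW] at this
    linarith
  have hab : ∀ n ω, |W (n + 1) ω - W n ω| ≤ a := by
    intro n ω
    rw [hW, hW]
    have := abs_norm_sub_norm_le (Δ (n + 1) ω) (Δ n ω)
    rw [hΔv] at this ⊢
    rwa [add_sub_cancel_left, hvn] at this
  have hW00 : ∀ ω, W 0 ω = 0 := by
    intro ω
    rw [hW, norm_eq_zero]
    ext i
    rw [hΔ, hZ0]; simp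
  have hW0 : ∀ n ω, 0 ≤ W n ω := fun n ω => by rw [hW]; exact norm_nonneg _
  have hWK : ∀ n ω, W n ω ≤ a * n := by
    intro n ω
    induction n with
    | zero => simp [hW00]
    | succ n ih =>
      have := (abs_le.1 (hab n ω)).2
      push_cast
      linarith
  have hdb : ∀ n ω, ‖Δ n ω (J n ω)‖ ≤ a * (a * n) := fun n ω =>
    (hd n ω).trans (mul_le_mul_of_nonneg_left (hWK n ω) hapos.le)
  have hdint : ∀ n, Integrable (fun ω => Δ n ω (J n ω)) μ := fun n =>
    Integrable.of_bound (hdm n).aestronglyMeasurable (a * (a * n)) (ae_of_all _ (hdb n))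
  have hBint : ∀ n (k : ℕ), Integrable
      (fun ω => Δ n ω (J n ω) * (if B n ω = k then (1 : ℝ) else 0)) μ := by
    intro n k
    refine (hdint n).mul_bdd (c := 1) ?_ (ae_of_all _ fun ω => ?_)
    · exact ((measurable_from_top (f := fun j : ℕ => if j = k then (1 : ℝ) else 0)).comp
        ((hBmeas n).mono (F.le _) le_rfl)).aestronglyMeasurable
    · split_ifs <;> simp
  have part1 : ∀ n, (μ[(fun ω => Δ n ω (J n ω)) | F n]) ≤ᵐ[μ] (fun ω => -(α * κ) * W n ω) := by
    intro n
    have hsplit : (fun ω => Δ n ω (J n ω))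
        = (fun ω => Δ n ω (J n ω) * (if B n ω = 1 then (1 : ℝ) else 0))
          + (fun ω => Δ n ω (J n ω) * (if B n ω = 0 then (1 : ℝ) else 0)) := by
      funext ω
      rcases hB01 n ω with h | h <;> simp [h]
    rw [hsplit]
    filter_upwards [condExp_add (hBint n 1) (hBint n 0) (F n), hdrift1 n, hdrift0 n] with ω h1 h2 h3
    rw [h1, Pi.add_apply]
    linarith
  have hEint : ∀ (η : ℝ) n, 0 < η → Integrable (fun ω => Real.exp (η * W n ω)) μ := by
    intro η n hη
    have := (hWm n).mono (F.le n) le_rfl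
    refine Integrable.of_bound (by fun_prop) (Real.exp (η * (a * n))) (ae_of_all _ fun ω => ?_)
    rw [Real.norm_of_nonneg (by positivity)]
    have := hWK n ω
    gcongr
  have key : ∀ η : ℝ, 0 < η → η < 2 * α * κ / a ^ 2 →
      ∃ M : ℝ, ∀ n, ∫⁻ ω, ENNReal.ofReal (Real.exp (η * W n ω)) ∂μ ≤ ENNReal.ofReal M := by
    intro η hη hη2
    rw [lt_div_iff₀ ha2pos] at hη2
    set δ := α * κ - η * a ^ 2 / 2 with hδ
    have hδp : 0 < δ := by rw [hδ]; linarith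
    set R := a ^ 2 / δ with hR
    have hRp : 0 < R := by positivity
    have hR2 : a ^ 2 / (2 * R) = δ / 2 := by rw [hR]; field_simp
    have hlt : Real.cosh (η * a) + Real.sinh (η * a) / a * (-(α * κ) + a ^ 2 / (2 * R)) < 1 := by
      have := mix_rho_lt (x := η * a) (c := (α * κ - δ / 2) / a) (by positivity) (by
        rw [lt_div_iff₀ hapos]
        rw [hδ]; nlinarith)
      rw [hR2]
      calc _ = _ := by ring
        _ < 1 := this
    set ρ := max 0 (Real.cosh (η * a) + Real.sinh (η * a) / a * (-(α * κ) + a ^ 2 / (2 * R)))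
      with hρ
    have hρ0 : 0 ≤ ρ := le_max_left _ _
    have hρ1 : ρ < 1 := max_lt one_pos hlt
    set C := Real.exp (η * (R + a)) with hC
    have hCp : 0 < C := Real.exp_pos _
    have hE : ∀ n, ∫ ω, Real.exp (η * W n ω) ∂μ ≤ 1 + C / (1 - ρ) := by
      intro n
      induction n with
      | zero =>
        simp only [hW00]
        have : 0 ≤ C / (1 - ρ) := div_nonneg hCp.le (by linarith)
        simp [this]
      | succ n ih =>
        have hstep := mix_step μ (F.le n) (K := a * n) (lam := α * κ) hapos hη hRp (hWm n)
          ((hWm (n + 1)).mono (F.le _) le_rfl) (hdm n) (hW0 n) (hWK n) (hW0 (n + 1)) (hd n)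
          (hsq n) (hab n) (part1 n) hρ0 (le_max_right _ _)
        have h1 : ρ * ∫ ω, Real.exp (η * W n ω) ∂μ ≤ ρ * (1 + C / (1 - ρ)) :=
          mul_le_mul_of_nonneg_left ih hρ0
        have h2 : C / (1 - ρ) * (1 - ρ) = C := div_mul_cancel₀ _ (by linarith)
        have h3 : ρ * (1 + C / (1 - ρ)) + C = ρ + C / (1 - ρ) := by
          linear_combination -h2
        linarith
    refine ⟨1 + C / (1 - ρ), fun n => ?_⟩
    rw [← ofReal_integral_eq_lintegral_ofReal (hEint η n hη) (ae_of_all _ fun ω => by positivity)]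
    exact ENNReal.ofReal_le_ofReal (hE n)
  refine ⟨part1, ?_, ?_⟩
  · set η := α * κ / a ^ 2 with hη
    have hηp : 0 < η := by positivity
    obtain ⟨M, hM⟩ := key η hηp (by rw [hη]; gcongr; linarith [hα.1])
    have hsumlt : ∑' n : ℕ, ∫⁻ ω, ENNReal.ofReal (1 / (n : ℝ) ^ 2) *
        ENNReal.ofReal (Real.exp (η * W n ω)) ∂μ < ⊤ := by
      calc _ ≤ ∑' n : ℕ, ENNReal.ofReal (1 / (n : ℝ) ^ 2) * ENNReal.ofReal M := by
            refine ENNReal.tsum_le_tsum fun n => ?_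
            rw [lintegral_const_mul' _ _ ENNReal.ofReal_ne_top]
            gcongr
            exact hM n
        _ = (∑' n : ℕ, ENNReal.ofReal (1 / (n : ℝ) ^ 2)) * ENNReal.ofReal M := ENNReal.tsum_mul_right
        _ < ⊤ := by
            refine ENNReal.mul_lt_top ?_ ENNReal.ofReal_lt_top
            exact (Real.summable_one_div_nat_pow.2 one_lt_two).tsum_ofReal_lt_top
    have hmeas : ∀ n : ℕ, Measurable (fun ω => ENNReal.ofReal (1 / (n : ℝ) ^ 2) *
        ENNReal.ofReal (Real.exp (η * W n ω))) := by
      intro n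
      have := (hWm n).mono (F.le n) le_rfl
      fun_prop
    rw [← lintegral_tsum fun n => (hmeas n).aemeasurable] at hsumlt
    have hae := ae_lt_top (Measurable.tsum hmeas) hsumlt.ne
    filter_upwards [hae] with ω hω j
    have ht := ENNReal.tendsto_atTop_zero_of_tsum_ne_top hω.ne
    have ht2 : Tendsto (fun n : ℕ => 1 / (n : ℝ) ^ 2 * Real.exp (η * W n ω)) atTop (nhds 0) := by
      have := (ENNReal.tendsto_toReal ENNReal.zero_ne_top).comp ht
      simp only [ENNReal.toReal_zero] at this
      refine this.congr fun n => ?_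
      simp only [Function.comp, ENNReal.toReal_mul]
      rw [ENNReal.toReal_ofReal (by positivity), ENNReal.toReal_ofReal (by positivity)]
    have ht3 : Tendsto (fun n : ℕ => (W n ω / n) ^ 2) atTop (nhds 0) := by
      have h4 := ht2.const_mul (2 / η ^ 2)
      rw [mul_zero] at h4
      refine squeeze_zero (fun n => by positivity) (fun n => ?_) h4
      have hq := Real.quadratic_le_exp_of_nonneg (mul_nonneg hηp.le (hW0 n ω))
      have hq2 : W n ω ^ 2 ≤ 2 / η ^ 2 * Real.exp (η * W n ω) := by
        rw [div_mul_eq_mul_div, le_div_iff₀ (by positivity)]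
        have := mul_nonneg hηp.le (hW0 n ω)
        nlinarith
      calc (W n ω / n) ^ 2 = 1 / (n : ℝ) ^ 2 * W n ω ^ 2 := by ring
        _ ≤ 1 / (n : ℝ) ^ 2 * (2 / η ^ 2 * Real.exp (η * W n ω)) := by gcongr
        _ = _ := by ring
    have ht5 : Tendsto (fun n : ℕ => W n ω / n) atTop (nhds 0) := by
      have := (Real.continuous_sqrt.tendsto 0).comp ht3
      rw [Real.sqrt_zero] at this
      refine this.congr fun n => ?_
      simp only [Function.comp]
      exact Real.sqrt_sq (div_nonneg (hW0 n ω) (Nat.cast_nonneg n))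
    have ht6 : Tendsto (fun n : ℕ => Δ n ω j / n) atTop (nhds 0) := by
      refine squeeze_zero_norm (fun n => ?_) ht5
      rw [norm_div, Real.norm_natCast, hW]
      gcongr
      exact PiLp.norm_apply_le (Δ n ω) j
    have ht7 := ht6.add_const (1 / (s : ℝ))
    rw [zero_add] at ht7
    refine ht7.congr' ?_
    filter_upwards [eventually_gt_atTop 0] with n hn
    have hn' : (n : ℝ) ≠ 0 := by positivity
    rw [hΔ]
    field_simp
    ring
  · intro η hη hη2
    obtain ⟨M, hM⟩ := key η hη hη2
    exact (iSup_le hM).trans_lt ENNReal.ofReal_lt_top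
end

section
/- Let ℓ ∈ ℕ, p ∈ (0,1), and r ∈ (0,1), and let N and N' be independent random variables each distributed Binomial(ℓ, p). Define α := p√r/(1 − p + p√r) ∈ (0,1) and F_{ℓ,r}(α) := ∫_{[−π,π]} |(1−α) + α e^{iθ}|^{2ℓ} dμ_{√r}(θ), where μ_{√r} is the Poisson-kernel probability measure with parameter √r. Then E[r^{max(N, N')}] = (1 − p + p√r)^{2ℓ} · F_{ℓ,r}(α). -/
open MeasureTheory ProbabilityTheory
open scoped Real ENNReal

/-- The Poisson-kernel probability measure `μ_ρ` on `[−π, π]` with density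
`P_ρ(θ)/(2π)`, `P_ρ(θ) = (1−ρ²)/(1−2ρcos θ + ρ²)`. -/
noncomputable def poissonKernelMeasure (ρ : ℝ) : Measure ℝ :=
  (volume.restrict (Set.Icc (-π) π)).withDensity
    (fun θ => ENNReal.ofReal ((1 - ρ ^ 2) / (1 - 2 * ρ * Real.cos θ + ρ ^ 2) / (2 * π)))

lemma momentA (s : ℝ) (h0 : 0 < s) (h1 : s < 1) (n : ℕ) :
   ∫ θ in (-π)..π, (1 - s ^ 2) / (1 - 2 * s * Real.cos θ + s ^ 2) / (2 * π) * Real.cos (n*θ) = s ^ n := by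
  have hf : DiffContOnCl ℂ (fun z : ℂ => z ^ n) (Metric.ball 0 1) :=
    (differentiable_id.pow n).diffContOnCl
  have hw : (s:ℂ) ∈ Metric.ball (0:ℂ) 1 := by simp [abs_of_pos h0, h1]
  have h := hf.circleAverage_poissonKernel_smul hw
  rw [Real.circleAverage_def] at h
  have hden : ∀ θ : ℝ, 1 - 2 * s * Real.cos θ + s ^ 2 ≠ 0 := by
    intro θ
    have := Real.cos_le_one θ
    nlinarith [mul_nonneg h0.le (sub_nonneg.2 this), pow_pos (sub_pos.2 h1) 2]
  have hk : ∀ θ : ℝ, (poissonKernel 0 (s:ℂ) • (fun z : ℂ => z ^ n)) (circleMap 0 1 θ)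
     = (((1 - s ^ 2) / (1 - 2 * s * Real.cos θ + s ^ 2) : ℝ) : ℂ) * Complex.exp ((n * θ : ℝ) * Complex.I) := by
    intro θ
    have e : ‖circleMap 0 1 θ - (s:ℂ)‖^2 = 1 - 2 * s * Real.cos θ + s ^ 2 := by
      rw [← Complex.normSq_eq_norm_sq, Complex.normSq_apply]
      simp [circleMap, Complex.exp_ofReal_mul_I_re, Complex.exp_ofReal_mul_I_im]
      nlinarith [Real.sin_sq_add_cos_sq θ]
    have e2 : (circleMap 0 1 θ)^n = Complex.exp ((n * θ : ℝ) * Complex.I) := by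
      simp [circleMap, ← Complex.exp_nat_mul]; ring_nf
    simp only [Pi.smul_apply', Complex.real_smul, e2, poissonKernel_def, sub_zero, e]
    simp
  simp_rw [hk] at h
  have hc : Continuous fun θ : ℝ => (((1 - s ^ 2) / (1 - 2 * s * Real.cos θ + s ^ 2) : ℝ) : ℂ) * Complex.exp ((n * θ : ℝ) * Complex.I) := by
    refine (Complex.continuous_ofReal.comp (Continuous.div (by fun_prop) (by fun_prop) hden)).mul (by fun_prop)
  have h2 := congrArg Complex.re h
  rw [Complex.smul_re, ← Complex.reCLM_apply, ← ContinuousLinearMap.intervalIntegral_comp_comm _ (hc.intervalIntegrable _ _)] at h2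
  simp only [Complex.reCLM_apply, Complex.re_ofReal_mul, Complex.exp_ofReal_mul_I_re, ← Complex.ofReal_pow, Complex.ofReal_re] at h2
  have hper : Function.Periodic (fun θ : ℝ => (1 - s ^ 2) / (1 - 2 * s * Real.cos θ + s ^ 2) * Real.cos (n*θ)) (2*π) := by
    intro θ
    simp only [Real.cos_add_two_pi, mul_add, Real.cos_add_nat_mul_two_pi]
  have h3 := hper.intervalIntegral_add_eq 0 (-π)
  rw [zero_add, show -π + 2*π = π by ring] at h3
  rw [h3, smul_eq_mul, ← intervalIntegral.integral_const_mul] at h2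
  rw [← h2]
  congr 1; ext θ; ring

lemma momentB (s : ℝ) (h0 : 0 < s) (h1 : s < 1) (j k : ℕ) :
   s^(j+k) * ∫ θ in (-π)..π, (1 - s ^ 2) / (1 - 2 * s * Real.cos θ + s ^ 2) / (2 * π) * Real.cos (j*θ - k*θ) = (s ^ 2)^(max j k) := by
  rcases le_total j k with h | h
  · obtain ⟨m, rfl⟩ := Nat.exists_eq_add_of_le h
    have := momentA s h0 h1 m
    have e : ∀ θ : ℝ, Real.cos (j*θ - (j+m:ℕ)*θ) = Real.cos (m*θ) := by
      intro θ; rw [← Real.cos_neg]; congr 1; push_cast; ring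
    simp_rw [e, this]; rw [max_eq_right h]; ring
  · obtain ⟨m, rfl⟩ := Nat.exists_eq_add_of_le h
    have := momentA s h0 h1 m
    have e : ∀ θ : ℝ, Real.cos ((k+m:ℕ)*θ - k*θ) = Real.cos (m*θ) := by
      intro θ; congr 1; push_cast; ring
    simp_rw [e, this]; rw [max_eq_left h]; ring

lemma normExp (ℓ : ℕ) (p s θ : ℝ) :
   ‖((1 - p : ℝ):ℂ) + (p * s : ℝ) * Complex.exp ((θ : ℂ) * Complex.I)‖ ^ (2 * ℓ) =
   ∑ j ∈ Finset.range (ℓ+1), ∑ k ∈ Finset.range (ℓ+1),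
     ((ℓ.choose j : ℝ) * p ^ j * (1 - p) ^ (ℓ - j)) * ((ℓ.choose k : ℝ) * p ^ k * (1 - p) ^ (ℓ - k)) * s^(j+k) * Real.cos (j*θ-k*θ) := by
  set z := ((1 - p : ℝ):ℂ) + (p * s : ℝ) * Complex.exp ((θ : ℂ) * Complex.I) with hz
  have e : z^ℓ = ∑ j ∈ Finset.range (ℓ+1), (((ℓ.choose j : ℝ) * p ^ j * (1 - p) ^ (ℓ - j) * s^j : ℝ):ℂ) * Complex.exp ((j*θ : ℝ) * Complex.I) := by
    rw [hz, add_comm, add_pow]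
    refine Finset.sum_congr rfl fun j _ => ?_
    rw [mul_pow, ← Complex.exp_nat_mul]; push_cast; ring_nf
  rw [mul_comm, pow_mul, ← norm_pow, e, ← Complex.normSq_eq_norm_sq, Complex.normSq_apply]
  simp only [Complex.re_sum, Complex.im_sum, Complex.re_ofReal_mul, Complex.im_ofReal_mul, Complex.exp_ofReal_mul_I_re, Complex.exp_ofReal_mul_I_im]
  rw [Finset.sum_mul_sum, Finset.sum_mul_sum, ← Finset.sum_add_distrib]
  refine Finset.sum_congr rfl fun j _ => ?_
  rw [← Finset.sum_add_distrib]
  refine Finset.sum_congr rfl fun k _ => ?_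
  rw [Real.cos_sub]; ring

lemma lhs (ℓ : ℕ) (b : ℕ → ℝ) (hb : ∀ k, 0 ≤ b k) (hb0 : ∀ k, ℓ < k → b k = 0) (g : ℕ → ℕ → ℝ)
    {Ω : Type} {mΩ : MeasurableSpace Ω} (μ : Measure Ω) [IsProbabilityMeasure μ]
    (N N' : Ω → ℕ) (hN : Measurable N) (hN' : Measurable N')
    (h1 : ∀ k : ℕ, μ {ω | N ω = k} = ENNReal.ofReal (b k))
    (h2 : ∀ k : ℕ, μ {ω | N' ω = k} = ENNReal.ofReal (b k))
    (hindep : IndepFun N N' μ) :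
    ∫ ω, g (N ω) (N' ω) ∂μ = ∑ j ∈ Finset.range (ℓ+1), ∑ k ∈ Finset.range (ℓ+1), b j * b k * g j k := by
  have aux : ∀ M : Ω → ℕ, (∀ k : ℕ, μ {ω | M ω = k} = ENNReal.ofReal (b k)) → ∀ᵐ ω ∂μ, M ω ∈ Finset.range (ℓ+1) := by
    intro M h
    have : ∀ᵐ ω ∂μ, ∀ k, ℓ < k → M ω ≠ k := by
      rw [ae_all_iff]; intro k
      by_cases hk : ℓ < k
      · rw [ae_iff]; simp [hk, h, hb0 k hk]
      · simp [hk]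
    filter_upwards [this] with ω hω
    by_contra hc
    simp at hc
    exact hω _ hc rfl
  have ms : ∀ j k, MeasurableSet (N ⁻¹' {j} ∩ N' ⁻¹' {k}) := fun j k =>
    (hN (measurableSet_singleton j)).inter (hN' (measurableSet_singleton k))
  have e : ∀ᵐ ω ∂μ, g (N ω) (N' ω) = ∑ j ∈ Finset.range (ℓ+1), ∑ k ∈ Finset.range (ℓ+1),
      (N ⁻¹' {j} ∩ N' ⁻¹' {k}).indicator (fun _ => g j k) ω := by
    filter_upwards [aux N h1, aux N' h2] with ω ha hb
    rw [Finset.sum_eq_single_of_mem _ ha, Finset.sum_eq_single_of_mem _ hb]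
    · simp
    · intro k _ hk; simp [hk.symm]
    · intro j _ hj; simp [hj.symm]
  rw [integral_congr_ae e, integral_finset_sum]
  swap
  · intro j _
    exact integrable_finset_sum _ fun k _ => (integrable_const _).indicator (ms j k)
  refine Finset.sum_congr rfl fun j _ => ?_
  rw [integral_finset_sum]
  swap
  · exact fun k _ => (integrable_const _).indicator (ms j k)
  refine Finset.sum_congr rfl fun k _ => ?_
  rw [integral_indicator_const _ (ms j k), smul_eq_mul, Measure.real,
    hindep.measure_inter_preimage_eq_mul _ _ (measurableSet_singleton j) (measurableSet_singleton k)]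
  have a1 : μ (N ⁻¹' {j}) = _ := h1 j
  have a2 : μ (N' ⁻¹' {k}) = _ := h2 k
  rw [a1, a2, ENNReal.toReal_mul, ENNReal.toReal_ofReal (hb j), ENNReal.toReal_ofReal (hb k)]

/-- Exact Poisson-kernel representation, part (i): identity.
For independent `N, N' ∼ Binomial(ℓ, p)` and `r ∈ (0,1)`, with
`α = p√r/(1 − p + p√r)` and
`F_{ℓ,r}(α) = ∫ |(1−α) + αe^{iθ}|^{2ℓ} dμ_{√r}(θ)`, one has
`E[r^{max(N,N')}] = (1 − p + p√r)^{2ℓ} · F_{ℓ,r}(α)`. -/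
theorem stmt14 (ℓ : ℕ) (p : ℝ) (hp : p ∈ Set.Ioo (0 : ℝ) 1)
    (r : ℝ) (hr : r ∈ Set.Ioo (0 : ℝ) 1)
    {Ω : Type} {mΩ : MeasurableSpace Ω} (μ : Measure Ω) [IsProbabilityMeasure μ]
    (N N' : Ω → ℕ) (hN : Measurable N) (hN' : Measurable N')
    (hNlaw : ∀ k : ℕ,
        μ {ω | N ω = k} =
          ENNReal.ofReal ((ℓ.choose k : ℝ) * p ^ k * (1 - p) ^ (ℓ - k)))
    (hN'law : ∀ k : ℕ,
        μ {ω | N' ω = k} =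
          ENNReal.ofReal ((ℓ.choose k : ℝ) * p ^ k * (1 - p) ^ (ℓ - k)))
    (hindep : IndepFun N N' μ)
    (α : ℝ) (hα : α = p * Real.sqrt r / (1 - p + p * Real.sqrt r)) :
    ∫ ω, r ^ max (N ω) (N' ω) ∂μ
      = (1 - p + p * Real.sqrt r) ^ (2 * ℓ) *
          ∫ θ, ‖(1 - α) + α * Complex.exp ((θ : ℂ) * Complex.I)‖ ^ (2 * ℓ)
            ∂(poissonKernelMeasure (Real.sqrt r)) := by
  obtain ⟨hp0, hp1⟩ := hp
  obtain ⟨hr0, hr1⟩ := hr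
  have hs0 : 0 < Real.sqrt r := Real.sqrt_pos.2 hr0
  have hs1 : Real.sqrt r < 1 := by rw [Real.sqrt_lt' one_pos]; simpa using hr1
  have hrs : r = Real.sqrt r ^ 2 := (Real.sq_sqrt hr0.le).symm
  rw [lhs ℓ (fun k => (ℓ.choose k : ℝ) * p ^ k * (1 - p) ^ (ℓ - k))
    (fun k => mul_nonneg (mul_nonneg (by positivity) (by positivity)) (pow_nonneg (by linarith) _))
    (fun k hk => by simp [Nat.choose_eq_zero_of_lt hk]) (fun j k => r ^ max j k) μ N N' hN hN'
    hNlaw hN'law hindep]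
  generalize Real.sqrt r = s at *
  subst hrs
  have hD : 0 < 1 - p + p * s := by nlinarith [mul_pos hp0 hs0]
  have hden : ∀ θ : ℝ, 0 < 1 - 2 * s * Real.cos θ + s ^ 2 := by
    intro θ
    have := Real.cos_le_one θ
    nlinarith [mul_nonneg hs0.le (sub_nonneg.2 this), pow_pos (sub_pos.2 hs1) 2]
  have hcont : Continuous fun θ : ℝ => (1 - s ^ 2) / (1 - 2 * s * Real.cos θ + s ^ 2) / (2 * π) :=
    (Continuous.div (by fun_prop) (by fun_prop) fun θ => (hden θ).ne').div_const _
  have hnn : ∀ θ : ℝ, 0 ≤ (1 - s ^ 2) / (1 - 2 * s * Real.cos θ + s ^ 2) / (2 * π) := fun θ =>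
    div_nonneg (div_nonneg (by nlinarith) (hden θ).le) (by positivity)
  rw [← integral_const_mul]
  have hpt : ∀ θ : ℝ, (1 - p + p * s) ^ (2 * ℓ) *
      ‖(1 - α : ℂ) + α * Complex.exp ((θ : ℂ) * Complex.I)‖ ^ (2 * ℓ) =
      ‖((1 - p : ℝ):ℂ) + (p * s : ℝ) * Complex.exp ((θ : ℂ) * Complex.I)‖ ^ (2 * ℓ) := by
    intro θ
    rw [← mul_pow]
    congr 1
    have hD' : ((1 - p + p * s : ℝ) : ℂ) ≠ 0 := by exact_mod_cast hD.ne'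
    rw [← Real.norm_of_nonneg hD.le, ← Complex.norm_real, ← norm_mul]
    congr 1
    rw [hα]
    push_cast at hD' ⊢
    field_simp
    ring
  simp_rw [hpt, normExp]
  rw [poissonKernelMeasure, integral_withDensity_eq_integral_toReal_smul
    (by fun_prop) (by simp)]
  simp_rw [ENNReal.toReal_ofReal (hnn _), smul_eq_mul]
  rw [integral_Icc_eq_integral_Ioc, ← intervalIntegral.integral_of_le (by linarith [Real.pi_pos])]
  simp_rw [Finset.mul_sum]
  rw [intervalIntegral.integral_finset_sum]
  swap
  · intro j _
    exact Continuous.intervalIntegrable (by fun_prop) _ _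
  refine Finset.sum_congr rfl fun j _ => ?_
  rw [intervalIntegral.integral_finset_sum]
  swap
  · intro k _
    exact Continuous.intervalIntegrable (by fun_prop) _ _
  refine Finset.sum_congr rfl fun k _ => ?_
  rw [← momentB s hs0 hs1 j k, ← mul_assoc, ← intervalIntegral.integral_const_mul]
  congr 1; ext θ; ring
end

section
/- Fix r ∈ (0,1) and α ∈ (0,1), and define F_{ℓ,r}(α) := ∫_{[−π,π]} |(1−α) + α e^{iθ}|^{2ℓ} dμ_{√r}(θ), where μ_{√r} is the Poisson-kernel probability measure with parameter √r. Then √ℓ · F_{ℓ,r}(α) converges, as ℓ → ∞, to the positive constant (1+√r) / ((1−√r) · √(2π) · √(2α(1−α))). In particular F_{ℓ,r}(α) ≍ ℓ^{−1/2} as ℓ → ∞. -/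
open MeasureTheory Filter
open scoped Real ENNReal

lemma normsq_aux (α θ : ℝ) :
    ‖((1:ℂ) - α) + α * Complex.exp ((θ : ℂ) * Complex.I)‖ ^ 2
      = 1 + -(2 * α * (1 - α) * (1 - Real.cos θ)) := by
  rw [Complex.sq_norm, Complex.normSq_apply, Complex.exp_mul_I]
  simp [← Complex.ofReal_cos, ← Complex.ofReal_sin]
  linear_combination α ^ 2 * Real.sin_sq_add_cos_sq θ

lemma one_sub_cos_aux (x : ℝ) : 1 - Real.cos x = x ^ 2 / 2 * (Real.sinc (x / 2)) ^ 2 := by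
  have h : Real.cos x = 1 - 2 * Real.sin (x / 2) ^ 2 := by
    have := Real.cos_two_mul (x / 2)
    rw [show 2 * (x / 2) = x by ring] at this
    nlinarith [Real.sin_sq_add_cos_sq (x / 2)]
  by_cases hx : x = 0
  · simp [hx]
  · rw [h, Real.sinc_of_ne_zero (by positivity)]
    field_simp
    ring

lemma div_sqrt_tendsto (t : ℝ) : Tendsto (fun n : ℕ => t / Real.sqrt n) atTop (nhds 0) :=
  Tendsto.const_div_atTop (Real.tendsto_sqrt_atTop.comp tendsto_natCast_atTop_atTop) t

lemma pow_tendsto_aux (c t : ℝ) :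
    Tendsto (fun n : ℕ => (1 + -(c * (1 - Real.cos (t / Real.sqrt n)))) ^ n) atTop
      (nhds (Real.exp (-(c / 2) * t ^ 2))) := by
  apply Real.tendsto_one_add_pow_exp_of_tendsto
  have h1 : Tendsto (fun n : ℕ => Real.sinc (t / Real.sqrt n / 2)) atTop (nhds 1) := by
    have := (Real.continuous_sinc.tendsto 0).comp
      (by simpa using (div_sqrt_tendsto t).div_const 2)
    simpa [Function.comp_def] using this
  have h2 : Tendsto (fun n : ℕ => -(c / 2) * t ^ 2 * (Real.sinc (t / Real.sqrt n / 2)) ^ 2) atTop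
      (nhds (-(c / 2) * t ^ 2)) := by
    have := (h1.pow 2).const_mul (-(c / 2) * t ^ 2)
    rwa [one_pow, mul_one] at this
  refine h2.congr' ?_
  filter_upwards [eventually_gt_atTop 0] with n hn
  have hn' : (0:ℝ) < n := by exact_mod_cast hn
  rw [one_sub_cos_aux, div_pow t, Real.sq_sqrt hn'.le]
  field_simp

theorem stmt15 (r α : ℝ) (hr : r ∈ Set.Ioo (0 : ℝ) 1) (hα : α ∈ Set.Ioo (0 : ℝ) 1)
    (F : ℕ → ℝ)
    (hF : ∀ ℓ : ℕ, F ℓ =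
        ∫ θ, ‖(1 - α) + α * Complex.exp ((θ : ℂ) * Complex.I)‖ ^ (2 * ℓ)
          ∂(poissonKernelMeasure (Real.sqrt r))) :
    0 < (1 + Real.sqrt r) /
          ((1 - Real.sqrt r) * Real.sqrt (2 * π) * Real.sqrt (2 * α * (1 - α))) ∧
    Tendsto (fun ℓ : ℕ => Real.sqrt ℓ * F ℓ) atTop
      (nhds ((1 + Real.sqrt r) /
        ((1 - Real.sqrt r) * Real.sqrt (2 * π) * Real.sqrt (2 * α * (1 - α))))) := by
  obtain ⟨hr0, hr1⟩ := hr
  obtain ⟨ha0, ha1⟩ := hα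
  set ρ := Real.sqrt r with hρ
  have hρ0 : 0 < ρ := Real.sqrt_pos.mpr hr0
  have hρ1 : ρ < 1 := by rw [hρ, Real.sqrt_lt' one_pos]; simpa using hr1
  have hρs : 0 < 1 - ρ := by linarith
  set c := 2 * α * (1 - α) with hc
  have hc0 : 0 < c := by have : 0 < 1 - α := by linarith
                         positivity
  have hc1 : 2 * c ≤ 1 := by nlinarith [sq_nonneg (2 * α - 1)]
  have hpi := Real.pi_pos
  refine ⟨by positivity, ?_⟩
  set p : ℝ → ℝ := fun θ => (1 - ρ ^ 2) / (1 - 2 * ρ * Real.cos θ + ρ ^ 2) / (2 * π) with hp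
  have hden : ∀ θ, (1 - ρ) ^ 2 ≤ 1 - 2 * ρ * Real.cos θ + ρ ^ 2 := fun θ => by
    nlinarith [Real.cos_le_one θ]
  have hden0 : ∀ θ, 0 < 1 - 2 * ρ * Real.cos θ + ρ ^ 2 := fun θ =>
    lt_of_lt_of_le (by positivity) (hden θ)
  have hnum : 0 ≤ 1 - ρ ^ 2 := by nlinarith
  have hp0 : ∀ θ, 0 ≤ p θ := fun θ => by
    have := hden0 θ
    simp only [hp]; positivity
  have hpcont : Continuous p := by
    simp only [hp]
    exact (Continuous.div (by fun_prop) (by fun_prop) (fun θ => (hden0 θ).ne')).div_const _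
  set C := (1 - ρ ^ 2) / (1 - ρ) ^ 2 / (2 * π) with hC
  have hpC : ∀ θ, p θ ≤ C := fun θ => by
    simp only [hp, hC]
    have := hden θ
    gcongr
  have hC0 : 0 ≤ C := (hp0 0).trans (hpC 0)
  set G : ℕ → ℝ → ℝ := fun n => (Set.Icc (-π) π).indicator
    (fun θ => p θ * (1 + -(c * (1 - Real.cos θ))) ^ n) with hG
  have hFG : ∀ n, F n = ∫ θ, G n θ := by
    intro n
    rw [hF, poissonKernelMeasure, integral_withDensity_eq_integral_toReal_smul]
    · rw [hG, integral_indicator measurableSet_Icc]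
      congr 1
      ext θ
      rw [ENNReal.toReal_ofReal (hp0 θ), pow_mul, normsq_aux, smul_eq_mul]
    · exact hpcont.measurable.ennreal_ofReal
    · exact Eventually.of_forall fun _ => ENNReal.ofReal_lt_top
  have hscale : ∀ n : ℕ, Real.sqrt n * F n = ∫ t, G n (t / Real.sqrt n) := by
    intro n
    rw [hFG, Measure.integral_comp_div, abs_of_nonneg (Real.sqrt_nonneg _), smul_eq_mul]
  simp_rw [hscale]
  have hlim : (1 + ρ) / ((1 - ρ) * Real.sqrt (2 * π) * Real.sqrt c)
      = ∫ t : ℝ, p 0 * Real.exp (-(c / 2) * t ^ 2) := by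
    rw [integral_const_mul, integral_gaussian]
    have h1 : p 0 = (1 + ρ) / (1 - ρ) / (2 * π) := by
      simp only [hp, Real.cos_zero]
      rw [show 1 - 2 * ρ * 1 + ρ ^ 2 = (1 - ρ) ^ 2 by ring]
      field_simp
      ring
    rw [h1, show π / (c / 2) = (2 * π) / c by field_simp, Real.sqrt_div (by positivity)]
    have h2 : Real.sqrt (2 * π) ^ 2 = 2 * π := Real.sq_sqrt (by positivity)
    have h3 : 0 < Real.sqrt (2 * π) := by positivity
    have h4 : 0 < Real.sqrt c := by positivity
    generalize Real.sqrt (2 * π) = s at *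
    rw [← h2]
    field_simp
  rw [hlim]
  rw [← tendsto_add_atTop_iff_nat 1]
  apply tendsto_integral_of_dominated_convergence
    (fun t => C * Real.exp (-(2 * c / π ^ 2) * t ^ 2))
  · intro m
    generalize m + 1 = n
    have : Measurable (G n) := by
      apply Measurable.indicator _ measurableSet_Icc
      exact (hpcont.mul (by fun_prop)).measurable
    exact (this.comp (measurable_id.div_const _)).aestronglyMeasurable
  · exact (integrable_exp_neg_mul_sq (by positivity)).const_mul _
  · intro m
    obtain ⟨n, hn0⟩ : ∃ n, n = m + 1 := ⟨_, rfl⟩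
    rw [← hn0]
    have hn : 0 < n := by omega
    refine Eventually.of_forall fun t => ?_
    simp only [hG]
    by_cases hmem : t / Real.sqrt n ∈ Set.Icc (-π) π
    · rw [Set.indicator_of_mem hmem]
      set x := t / Real.sqrt n with hx
      have hb : 0 ≤ 1 + -(c * (1 - Real.cos x)) := by
        nlinarith [Real.neg_one_le_cos x]
      rw [Real.norm_of_nonneg (mul_nonneg (hp0 _) (pow_nonneg hb _))]
      have hn' : (0:ℝ) < n := by exact_mod_cast hn
      have hq := Real.cos_le_one_sub_mul_cos_sq (abs_le.mpr hmem)
      have hnx : n * x ^ 2 = t ^ 2 := by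
        rw [hx, div_pow, Real.sq_sqrt hn'.le]; field_simp
      refine mul_le_mul (hpC _) ?_ (pow_nonneg hb _) hC0
      calc (1 + -(c * (1 - Real.cos x))) ^ n ≤ (Real.exp (-(2 * c / π ^ 2) * x ^ 2)) ^ n := by
            apply pow_le_pow_left₀ hb
            refine le_trans ?_ (Real.add_one_le_exp _)
            have : c * (2 / π ^ 2 * x ^ 2) ≤ c * (1 - Real.cos x) :=
              mul_le_mul_of_nonneg_left (by linarith) hc0.le
            have e : -(2 * c / π ^ 2) * x ^ 2 = - (c * (2 / π ^ 2 * x ^ 2)) := by ring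
            linarith
        _ = _ := by
            rw [← Real.exp_nat_mul, ← hnx]
            congr 1; ring
    · rw [Set.indicator_of_notMem hmem]
      simp only [norm_zero]
      positivity
  · refine Eventually.of_forall fun t => ?_
    refine (tendsto_add_atTop_iff_nat (f := fun n : ℕ => G n (t / Real.sqrt n)) 1).mpr ?_
    have h0 := div_sqrt_tendsto t
    have h1 : Tendsto (fun n : ℕ => p (t / Real.sqrt n) *
        (1 + -(c * (1 - Real.cos (t / Real.sqrt n)))) ^ n) atTop
        (nhds (p 0 * Real.exp (-(c / 2) * t ^ 2))) :=
      ((hpcont.tendsto 0).comp h0).mul (pow_tendsto_aux c t)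
    refine h1.congr' ?_
    filter_upwards [h0.eventually (Icc_mem_nhds (neg_lt_zero.mpr hpi) hpi)] with n hn
    simp only [hG]
    rw [Set.indicator_of_mem (Set.mem_Icc.mpr hn)]
end

section
/- Define φ : ℕ × ℕ → ℝ by φ(z) = 2^{−2z₁} + 2^{−2z₂} and ψ : (ℕ×ℕ) × (ℕ×ℕ) → ℝ by ψ(z, z') = 2^{−2·max(z₁, z'₁)} + 2^{−2·max(z₂, z'₂)}. Let η be the probability mass function on ℕ × ℕ supported on six points with η(0,0) = 1/225, η(1,0) = η(0,1) = 14/225, η(2,0) = η(0,2) = 28/225, η(1,1) = 140/225, and for θ ∈ ℝ let η_θ := η + θ·(δ_{(2,0)} − δ_{(1,1)}), where δ_z is the point mass at z. For a real B ≥ 1 and a finitely supported μ define J_B(μ) := (1/B)·Σ_z φ(z)μ(z) + ((B−1)/B)·Σ_z Σ_{z'} ψ(z,z')μ(z)μ(z'). Then: (i) for every θ ∈ ℝ, J_B(η_θ) − J_B(η) = θ·(29 − 2B)/(48B) + θ²·(15(B−1))/(16B); and (ii) for every integer B ≥ 15 there exists θ ∈ (0, 140/225) such that η_θ is a probability mass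 function and J_B(η_θ) < J_B(η). -/
/-- Single-tree bias functional `φ(z) = 2^{−2z₁} + 2^{−2z₂}`. -/
noncomputable def phiFun (z : ℕ × ℕ) : ℝ :=
  (2 : ℝ) ^ (-(2 * (z.1 : ℤ))) + (2 : ℝ) ^ (-(2 * (z.2 : ℤ)))

/-- Cross-tree bias kernel `ψ(z,z') = 2^{−2·max(z₁,z'₁)} + 2^{−2·max(z₂,z'₂)}`. -/
noncomputable def psiFun (z z' : ℕ × ℕ) : ℝ :=
  (2 : ℝ) ^ (-(2 * ((max z.1 z'.1 : ℕ) : ℤ)))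
    + (2 : ℝ) ^ (-(2 * ((max z.2 z'.2 : ℕ) : ℤ)))

/-- The greedy terminal informative split-count law `η` on `ℕ × ℕ`. -/
noncomputable def etaGr : (ℕ × ℕ) →₀ ℝ :=
  Finsupp.single (0, 0) (1 / 225) + Finsupp.single (1, 0) (14 / 225)
    + Finsupp.single (0, 1) (14 / 225) + Finsupp.single (2, 0) (28 / 225)
    + Finsupp.single (0, 2) (28 / 225) + Finsupp.single (1, 1) (140 / 225)

/-- The perturbed law `η_θ = η + θ·(δ_{(2,0)} − δ_{(1,1)})`. -/
noncomputable def etaPert (θ : ℝ) : (ℕ × ℕ) →₀ ℝ :=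
  etaGr + θ • (Finsupp.single (2, 0) (1 : ℝ) - Finsupp.single (1, 1) (1 : ℝ))

/-- The normalized zero-noise leading forest-MSE objective
`J_B(μ) = (1/B)·Σ_z φ(z)μ(z) + ((B−1)/B)·Σ_{z,z'} ψ(z,z')μ(z)μ(z')`
for finitely supported `μ`. -/
noncomputable def JB (B : ℝ) (μ : (ℕ × ℕ) →₀ ℝ) : ℝ :=
  (1 / B) * μ.sum (fun z a => phiFun z * a)
    + ((B - 1) / B) * μ.sum (fun z a => μ.sum (fun z' a' => psiFun z z' * a * a'))

theorem etaPert_eq (θ : ℝ) : etaPert θ =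
    Finsupp.single (0, 0) (1 / 225) + Finsupp.single (1, 0) (14 / 225)
    + Finsupp.single (0, 1) (14 / 225) + Finsupp.single (2, 0) (28 / 225 + θ)
    + Finsupp.single (0, 2) (28 / 225) + Finsupp.single (1, 1) (140 / 225 - θ) := by
  unfold etaPert etaGr
  rw [smul_sub, Finsupp.smul_single, Finsupp.smul_single, Finsupp.single_add, Finsupp.single_sub]
  simp only [smul_eq_mul, mul_one]
  abel

/-- Sums of a linear functional against the perturbed law. -/
theorem etaPert_sum (θ : ℝ) (f : ℕ × ℕ → ℝ → ℝ) (h0 : ∀ z, f z 0 = 0)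
    (hadd : ∀ z a b, f z (a + b) = f z a + f z b) :
    (etaPert θ).sum f = f (0, 0) (1 / 225) + f (1, 0) (14 / 225) + f (0, 1) (14 / 225)
      + f (2, 0) (28 / 225 + θ) + f (0, 2) (28 / 225) + f (1, 1) (140 / 225 - θ) := by
  rw [etaPert_eq]
  iterate 5 rw [Finsupp.sum_add_index' h0 hadd]
  iterate 6 rw [Finsupp.sum_single_index (h0 _)]

theorem etaPert_zero : etaPert 0 = etaGr := by simp [etaPert]

theorem JB_etaPert (B θ : ℝ) :
    JB B (etaPert θ) = JB B (etaPert 0) +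
      ((1 / B) * (9 / 16 * θ) + ((B - 1) / B) * (-θ / 24 + 15 / 16 * θ ^ 2)) := by
  have inner (t : ℝ) (z : ℕ × ℕ) (a : ℝ) := etaPert_sum t (fun z' a' => psiFun z z' * a * a')
    (by intros; simp) (by intros; ring)
  unfold JB
  simp only [inner]
  iterate 4 rw [etaPert_sum _ _ (by intros; simp) (by intros; ring)]
  simp only [phiFun, psiFun]
  norm_num [zpow_neg]
  ring

theorem JB_diff (B : ℝ) (hB : 1 ≤ B) (θ : ℝ) :
    JB B (etaPert θ) - JB B etaGr
      = θ * (29 - 2 * B) / (48 * B) + θ ^ 2 * (15 * (B - 1)) / (16 * B) := by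
  have : B ≠ 0 := by positivity
  rw [JB_etaPert, etaPert_zero]
  field_simp
  ring

/-- quantitative core of Proposition 5: counterexample to CART's
global optimality. (i) For every real `B ≥ 1` and every `θ ∈ ℝ`,
`J_B(η_θ) − J_B(η) = θ·(29 − 2B)/(48B) + θ²·(15(B−1))/(16B)`.
(ii) For every integer `B ≥ 15` there exists `θ ∈ (0, 140/225)` such that `η_θ` is a
probability mass function and `J_B(η_θ) < J_B(η)`. -/
theorem stmt19 :
    (∀ B : ℝ, 1 ≤ B → ∀ θ : ℝ,
        JB B (etaPert θ) - JB B etaGr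
          = θ * (29 - 2 * B) / (48 * B) + θ ^ 2 * (15 * (B - 1)) / (16 * B)) ∧
    (∀ B : ℕ, 15 ≤ B →
        ∃ θ : ℝ, 0 < θ ∧ θ < 140 / 225 ∧
          (∀ z : ℕ × ℕ, 0 ≤ etaPert θ z) ∧
          ((etaPert θ).sum fun _ a => a) = 1 ∧
          JB (B : ℝ) (etaPert θ) < JB (B : ℝ) etaGr) := by
  refine ⟨JB_diff, fun B hB => ⟨1 / 1000, by norm_num, by norm_num, ?_, ?_, ?_⟩⟩
  · intro z
    rw [etaPert_eq]
    simp only [Finsupp.add_apply]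
    have h (w : ℕ × ℕ) (a : ℝ) (ha : 0 ≤ a) : 0 ≤ (Finsupp.single w a) z := by
      rw [Finsupp.single_apply]
      split_ifs <;> simp [ha]
    have := h (0, 0) (1 / 225) (by norm_num)
    have := h (1, 0) (14 / 225) (by norm_num)
    have := h (0, 1) (14 / 225) (by norm_num)
    have := h (2, 0) (28 / 225 + 1 / 1000) (by norm_num)
    have := h (0, 2) (28 / 225) (by norm_num)
    have := h (1, 1) (140 / 225 - 1 / 1000) (by norm_num)
    positivity
  · rw [etaPert_sum _ _ (by intros; rfl) (by intros; rfl)]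
    norm_num
  · have hB' : (15 : ℝ) ≤ B := by exact_mod_cast hB
    have key := JB_diff B (by linarith) (1 / 1000)
    have hneg : (1 / 1000 : ℝ) * (29 - 2 * B) / (48 * B)
        + (1 / 1000 : ℝ) ^ 2 * (15 * (B - 1)) / (16 * B) < 0 := by
      have : (1 / 1000 : ℝ) * (29 - 2 * B) / (48 * B)
        + (1 / 1000 : ℝ) ^ 2 * (15 * (B - 1)) / (16 * B)
        = ((1 / 1000 : ℝ) * (29 - 2 * B) + (1 / 1000 : ℝ) ^ 2 * (45 * (B - 1))) / (48 * B) := by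
        have : (B : ℝ) ≠ 0 := by positivity
        field_simp
        ring
      rw [this]
      apply div_neg_of_neg_of_pos
      · linarith
      · linarith
    linarith
end
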